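/- arXiv:2003.11993 — 2 statements merged into one kernel-verified Lean document; each statement's English description precedes it below -/
import Mathlib

section
/- Let g, c, n be integers with 3 ≤ g ≤ c ≤ n. The triplet (g,c,n) is v-admissible (i.e., there exists a graph with girth g, circumference c and n vertices) if and only if either g = c ≤ n, or g < c and n ≥ g - 1 + c/2. -/
open SimpleGraph Set

/-- Auxiliary distance on representations of points of the metric graph:
a point is represented by `(u, v, t)` with `u, v` adjacent and `t ∈ [0,1]`,
meaning the point on the edge `[u,v]` at distance `t` from `u`. -/
noncomputable def mgDistAux {V : Type} [Fintype V] [DecidableEq V] (G : SimpleGraph V)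
    (p q : V × V × ℝ) : ℝ :=
  min
    (min (if p.1 = q.1 ∧ p.2.1 = q.2.1 then |p.2.2 - q.2.2| else (Fintype.card V : ℝ) + 1)
         (if p.1 = q.2.1 ∧ p.2.1 = q.1 then |p.2.2 - (1 - q.2.2)| else (Fintype.card V : ℝ) + 1))
    (min (min (p.2.2 + (G.dist p.1 q.1 : ℝ) + q.2.2)
              (p.2.2 + (G.dist p.1 q.2.1 : ℝ) + (1 - q.2.2)))
         (min ((1 - p.2.2) + (G.dist p.2.1 q.1 : ℝ) + q.2.2)
              ((1 - p.2.2) + (G.dist p.2.1 q.2.1 : ℝ) + (1 - q.2.2))))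

/-- The points of the metric graph associated to a simple graph `G`:
the vertices together with the interior points of the edges. -/
def MGPoint {V : Type} (G : SimpleGraph V) : Type :=
  {p : V × V × ℝ // G.Adj p.1 p.2.1 ∧ p.2.2 ∈ Set.Icc (0 : ℝ) 1}

/-- The shortest-path distance on the metric graph associated to `G`
(every edge has length 1). -/
noncomputable def mgDist {V : Type} [Fintype V] [DecidableEq V] (G : SimpleGraph V)
    (p q : MGPoint G) : ℝ := mgDistAux G p.1 q.1

/-- Distance from a vertex `v` to a point of the metric graph. -/
noncomputable def mgVDist {V : Type} [Fintype V] [DecidableEq V] (G : SimpleGraph V)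
    (v : V) (x : MGPoint G) : ℝ :=
  min ((G.dist v x.1.1 : ℝ) + x.1.2.2) ((G.dist v x.1.2.1 : ℝ) + (1 - x.1.2.2))

/-- `γ` restricted to `[a,b]` is a geodesic in the metric graph of `G`
(an arc-length parametrization realizing distances). -/
def IsMGGeodesic {V : Type} [Fintype V] [DecidableEq V] (G : SimpleGraph V)
    (a b : ℝ) (γ : ℝ → MGPoint G) : Prop :=
  a ≤ b ∧ ∀ s ∈ Set.Icc a b, ∀ t ∈ Set.Icc a b, mgDist G (γ s) (γ t) = |s - t|

/-- A geodesic triangle in the metric graph of `G`: three geodesic sides whose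
endpoints match cyclically (distance `0` means equality of points). -/
structure MGTriangle {V : Type} [Fintype V] [DecidableEq V] (G : SimpleGraph V) where
  a1 : ℝ
  b1 : ℝ
  a2 : ℝ
  b2 : ℝ
  a3 : ℝ
  b3 : ℝ
  g1 : ℝ → MGPoint G
  g2 : ℝ → MGPoint G
  g3 : ℝ → MGPoint G
  h1 : IsMGGeodesic G a1 b1 g1
  h2 : IsMGGeodesic G a2 b2 g2
  h3 : IsMGGeodesic G a3 b3 g3
  glue1 : mgDist G (g1 b1) (g2 a2) = 0
  glue2 : mgDist G (g2 b2) (g3 a3) = 0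
  glue3 : mgDist G (g3 b3) (g1 a1) = 0

/-- The sharp thin constant `δ(T)` of a geodesic triangle: the infimum of the
`d ≥ 0` such that each side is contained in the `d`-neighborhood of the union of
the other two sides. -/
noncomputable def triangleDelta {V : Type} [Fintype V] [DecidableEq V] {G : SimpleGraph V}
    (T : MGTriangle G) : ℝ :=
  sInf {d : ℝ | 0 ≤ d ∧
    (∀ s ∈ Set.Icc T.a1 T.b1,
      (∃ t ∈ Set.Icc T.a2 T.b2, mgDist G (T.g1 s) (T.g2 t) ≤ d) ∨
      (∃ t ∈ Set.Icc T.a3 T.b3, mgDist G (T.g1 s) (T.g3 t) ≤ d)) ∧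
    (∀ s ∈ Set.Icc T.a2 T.b2,
      (∃ t ∈ Set.Icc T.a1 T.b1, mgDist G (T.g2 s) (T.g1 t) ≤ d) ∨
      (∃ t ∈ Set.Icc T.a3 T.b3, mgDist G (T.g2 s) (T.g3 t) ≤ d)) ∧
    (∀ s ∈ Set.Icc T.a3 T.b3,
      (∃ t ∈ Set.Icc T.a1 T.b1, mgDist G (T.g3 s) (T.g1 t) ≤ d) ∨
      (∃ t ∈ Set.Icc T.a2 T.b2, mgDist G (T.g3 s) (T.g2 t) ≤ d))}

/-- The hyperbolicity constant `δ(G)`: the supremum of `δ(T)` over all geodesic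
triangles `T` in the metric graph of `G`. -/
noncomputable def hypDelta {V : Type} [Fintype V] [DecidableEq V] (G : SimpleGraph V) : ℝ :=
  sSup {d : ℝ | ∃ T : MGTriangle G, d = triangleDelta T}

/-- The circumference of `G`: the length of a longest cycle. -/
noncomputable def circumference {V : Type} (G : SimpleGraph V) : ℕ :=
  sSup {n : ℕ | ∃ (a : V) (w : G.Walk a a), w.IsCycle ∧ w.length = n}

/-- `G` belongs to the class `𝒢(g,c,n)` of (connected) graphs with girth `g`,
circumference `c` and `n` vertices (vertex set `Fin n`). -/
def memGclass (g c : ℕ) {n : ℕ} (G : SimpleGraph (Fin n)) : Prop :=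
  G.Connected ∧ G.girth = g ∧ circumference G = c

/-- `A(g,c,n) = min {δ(G) : G ∈ 𝒢(g,c,n)}`. -/
noncomputable def Agcn (g c n : ℕ) : ℝ :=
  sInf {d : ℝ | ∃ G : SimpleGraph (Fin n), memGclass g c G ∧ d = hypDelta G}

/-- `B(g,c,n) = max {δ(G) : G ∈ 𝒢(g,c,n)}`. -/
noncomputable def Bgcn (g c n : ℕ) : ℝ :=
  sSup {d : ℝ | ∃ G : SimpleGraph (Fin n), memGclass g c G ∧ d = hypDelta G}

/-- `G` belongs to the class `ℋ(g,c,m)` of (connected) graphs with girth `g`,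
circumference `c` and `m` edges. -/
def memHclass (g c m : ℕ) {k : ℕ} (G : SimpleGraph (Fin k)) : Prop :=
  G.Connected ∧ G.girth = g ∧ circumference G = c ∧ G.edgeSet.ncard = m

/-- `α(g,c,m) = min {δ(G) : G ∈ ℋ(g,c,m)}`. -/
noncomputable def alphagcm (g c m : ℕ) : ℝ :=
  sInf {d : ℝ | ∃ (k : ℕ) (G : SimpleGraph (Fin k)), memHclass g c m G ∧ d = hypDelta G}

/-- `β(g,c,m) = max {δ(G) : G ∈ ℋ(g,c,m)}`. -/
noncomputable def betagcm (g c m : ℕ) : ℝ :=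
  sSup {d : ℝ | ∃ (k : ℕ) (G : SimpleGraph (Fin k)), memHclass g c m G ∧ d = hypDelta G}

/-- The edge `e` crosses the cut given by `S`. -/
def CrossesCut {V : Type} (S : V → Prop) (e : Sym2 V) : Prop :=
  ∃ a b, e = s(a, b) ∧ S a ∧ ¬ S b

theorem crossesCut_mk {V : Type} (S : V → Prop) (a b : V) :
    CrossesCut S s(a, b) ↔ ((S a ∧ ¬ S b) ∨ (S b ∧ ¬ S a)) := by
  unfold CrossesCut
  constructor
  · rintro ⟨x, y, h, hx, hy⟩
    rw [Sym2.eq_iff] at h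
    rcases h with ⟨rfl, rfl⟩ | ⟨rfl, rfl⟩ <;> tauto
  · rintro (h | h)
    · exact ⟨a, b, rfl, h⟩
    · exact ⟨b, a, Sym2.eq_swap, h⟩

open Classical in
theorem even_crossings_iff {V : Type} {G : SimpleGraph V} (S : V → Prop) {u v : V}
    (w : G.Walk u v) :
    Even (w.edges.countP (fun e => decide (CrossesCut S e))) ↔ (S u ↔ S v) := by
  induction w with
  | nil => simp
  | @cons a b c h p ih =>
    rw [Walk.edges_cons, List.countP_cons]
    by_cases ha : S a <;> by_cases hb : S b <;> by_cases hc : S c <;>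
      simp [crossesCut_mk, ha, hb, hc, Nat.even_add_one] at ih ⊢ <;> grind

theorem length_le_of_edges_subset {V : Type} {G : SimpleGraph V} {u v : V}
    (w : G.Walk u v) (hw : w.IsTrail) (L : List (Sym2 V)) (h : w.edges ⊆ L) :
    w.length ≤ L.length := by
  rw [← Walk.length_edges]
  exact (hw.edges_nodup.subperm h).length_le

theorem girth_le_of_two_paths {V : Type} {G : SimpleGraph V} {u v : V}
    (p q : G.Walk u v) (hp : p.IsPath) (hq : q.IsPath) (hne : p.edges ≠ q.edges) :
    G.girth ≤ p.length + q.length := by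
  let K : SimpleGraph V := SimpleGraph.fromEdgeSet {e | e ∈ p.edges ∨ e ∈ q.edges}
  have hK : ∀ e, e ∈ K.edgeSet → e ∈ p.edges ∨ e ∈ q.edges := by
    intro e he
    simp only [K, SimpleGraph.edgeSet_fromEdgeSet] at he
    exact he.1
  have hK1 : ∀ e ∈ p.edges, e ∈ K.edgeSet := by
    intro e he
    simp only [K, SimpleGraph.edgeSet_fromEdgeSet]
    exact ⟨Or.inl he, G.not_isDiag_of_mem_edgeSet (p.edges_subset_edgeSet he)⟩
  have hK2 : ∀ e ∈ q.edges, e ∈ K.edgeSet := by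
    intro e he
    simp only [K, SimpleGraph.edgeSet_fromEdgeSet]
    exact ⟨Or.inr he, G.not_isDiag_of_mem_edgeSet (q.edges_subset_edgeSet he)⟩
  have hKG : K ≤ G := by
    rw [← SimpleGraph.edgeSet_subset_edgeSet]
    intro e he
    rcases hK e he with h | h
    · exact p.edges_subset_edgeSet h
    · exact q.edges_subset_edgeSet h
  have hnac : ¬ K.IsAcyclic := by
    intro hac
    have := (isAcyclic_iff_subsingleton_path.1 hac u v).elim
      ⟨p.transfer K hK1, hp.transfer hK1⟩ ⟨q.transfer K hK2, hq.transfer hK2⟩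
    apply hne
    have h2 := congrArg (fun z : K.Path u v => z.1.edges) this
    simpa using h2
  have : ∃ (a : V) (w : K.Walk a a), w.IsCycle := by
    by_contra hcon
    push Not at hcon
    exact hnac (fun a w => hcon a w)
  obtain ⟨a, w, hw⟩ := this
  have h1 : G.girth ≤ (w.mapLe hKG).length := girth_le_length ((Walk.isCycle_mapLe hKG).2 hw)
  rw [Walk.length_mapLe] at h1
  have h2 := length_le_of_edges_subset w hw.isTrail (p.edges ++ q.edges) (by
    intro e he
    exact List.mem_append.2 (hK e (w.edges_subset_edgeSet he)))
  simp at h2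
  omega

theorem cycle_support_card {V : Type} [DecidableEq V] {G : SimpleGraph V} {u : V}
    (w : G.Walk u u) (hw : w.IsCycle) : w.support.toFinset.card = w.length := by
  have h : w.support.toFinset = w.support.tail.toFinset := by
    ext x
    have hu : u ∈ w.support.tail := Walk.end_mem_tail_support hw.not_nil
    rw [List.mem_toFinset, List.mem_toFinset, Walk.mem_support_iff]
    constructor
    · rintro (rfl | h)
      · exact hu
      · exact h
    · exact Or.inr
  rw [h, List.toFinset_card_of_nodup hw.support_nodup]
  simp

theorem forward_ear {n : ℕ} {G : SimpleGraph (Fin n)} {a : Fin n} (C : G.Walk a a)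
    (hC : C.IsCycle)
    (hear : ∃ u v, u ∈ C.support ∧ v ∈ C.support ∧ u ≠ v ∧
      (G.deleteEdges {e | e ∈ C.edges}).Reachable u v) :
    2 * G.girth + C.length ≤ 2 * n + 2 := by
  classical
  set H := G.deleteEdges {e | e ∈ C.edges} with hH
  have hHG : H ≤ G := SimpleGraph.deleteEdges_le _
  have hex : ∃ k, ∃ u v, u ∈ C.support ∧ v ∈ C.support ∧ u ≠ v ∧ H.Reachable u v ∧
      H.dist u v = k := by
    obtain ⟨u, v, h1, h2, h3, h4⟩ := hear
    exact ⟨_, u, v, h1, h2, h3, h4, rfl⟩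
  obtain ⟨u, v, hu, hv, huv, hr, hd⟩ := Nat.find_spec hex
  have hmin : ∀ x y, x ∈ C.support → y ∈ C.support → x ≠ y → H.Reachable x y →
      H.dist u v ≤ H.dist x y := by
    intro x y h1 h2 h3 h4
    rw [hd]
    exact Nat.find_min' hex ⟨x, y, h1, h2, h3, h4, rfl⟩
  obtain ⟨P, hP, hPl⟩ := hr.exists_path_of_dist
  have hPpos : P.length ≠ 0 := by
    intro h
    exact huv (Walk.eq_of_length_eq_zero h)
  have hinter : ∀ w, w ∈ P.support → w ∈ C.support → w = u ∨ w = v := by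
    intro w hwP hwC
    by_contra hcon
    push Not at hcon
    have h1 := Walk.length_takeUntil_lt_length hwP hcon.2
    have h2 := SimpleGraph.dist_le (P.takeUntil w hwP)
    have h3 := hmin u w hu hwC (Ne.symm hcon.1) (P.takeUntil w hwP).reachable
    omega
  have hPC : ∀ e ∈ P.edges, e ∉ C.edges := by
    intro e he
    have := P.edges_subset_edgeSet he
    rw [hH, SimpleGraph.edgeSet_deleteEdges] at this
    exact this.2
  have hcard : P.support.toFinset.card = P.length + 1 := by
    rw [List.toFinset_card_of_nodup hP.support_nodup]; simp
  have hcardC := cycle_support_card C hC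
  have hI : (P.support.toFinset ∩ C.support.toFinset).card ≤ 2 := by
    refine (Finset.card_le_card (t := {u, v}) ?_).trans (Finset.card_le_two)
    intro w hw
    simp only [Finset.mem_inter, List.mem_toFinset] at hw
    simpa using hinter w hw.1 hw.2
  have hU : (P.support.toFinset ∪ C.support.toFinset).card ≤ n := by
    simpa using Finset.card_le_univ (P.support.toFinset ∪ C.support.toFinset)
  have hUI := Finset.card_union_add_card_inter P.support.toFinset C.support.toFinset
  have harc : ∀ Q : G.Walk u v, Q.edges ⊆ C.edges → G.girth ≤ P.length + Q.length := by
    intro Q hQ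
    have h1 := girth_le_of_two_paths (P.mapLe hHG) Q.bypass
      ((Walk.isPath_mapLe hHG).2 hP) Q.bypass_isPath (by
        intro h
        rw [Walk.edges_mapLe_eq_edges] at h
        have : P.edges ≠ [] := by
          intro h0
          apply hPpos
          rw [← Walk.length_edges, h0]; rfl
        obtain ⟨e, he⟩ := List.exists_mem_of_ne_nil _ this
        apply hPC e he
        rw [h] at he
        exact hQ (Q.edges_bypass_subset_edges he))
    rw [Walk.length_mapLe] at h1
    have := Q.length_bypass_le_length
    omega
  have hv' : v ∈ (C.rotate u hu).support := by
    rw [Walk.mem_support_rotate_iff]; exact hv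
  have hspec := Walk.take_spec (C.rotate u hu) hv'
  have hlen := congrArg Walk.length hspec
  rw [Walk.length_append, Walk.length_rotate] at hlen
  have hsub : (C.rotate u hu).edges ⊆ C.edges := by
    intro e he
    exact (C.rotate_edges u hu).mem_iff.1 he
  have h1 := harc ((C.rotate u hu).takeUntil v hv')
    (fun e he => hsub (Walk.edges_takeUntil_subset_edges _ _ he))
  have h2 := harc ((C.rotate u hu).dropUntil v hv').reverse
    (fun e he => hsub (Walk.edges_dropUntil_subset_edges _ _ (by simpa using he)))
  rw [Walk.length_reverse] at h2
  omega

theorem forward_noear {n : ℕ} {G : SimpleGraph (Fin n)} {a b : Fin n} (C : G.Walk a a)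
    (hC : C.IsCycle) (D : G.Walk b b) (hD : D.IsCycle) (hlt : D.length < C.length)
    (hno : ∀ u v, u ∈ C.support → v ∈ C.support →
      (G.deleteEdges {e | e ∈ C.edges}).Reachable u v → u = v) :
    D.length + C.length ≤ n + 1 := by
  classical
  set H := G.deleteEdges {e | e ∈ C.edges} with hH
  by_cases hdis : ∀ e ∈ D.edges, e ∉ C.edges
  · have hDH : ∀ e ∈ D.edges, e ∈ H.edgeSet := by
      intro e he
      rw [hH, SimpleGraph.edgeSet_deleteEdges]
      exact ⟨D.edges_subset_edgeSet he, hdis e he⟩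
    let D' := D.transfer H hDH
    have hDs : D'.support = D.support := D.support_transfer hDH
    have hreach : ∀ x ∈ D.support, H.Reachable b x := by
      intro x hx
      rw [← hDs] at hx
      exact (D'.takeUntil x hx).reachable
    have hI : (D.support.toFinset ∩ C.support.toFinset).card ≤ 1 := by
      rw [Finset.card_le_one]
      intro x hx y hy
      simp only [Finset.mem_inter, List.mem_toFinset] at hx hy
      exact hno x y hx.2 hy.2 ((hreach x hx.1).symm.trans (hreach y hy.1))
    have hU : (D.support.toFinset ∪ C.support.toFinset).card ≤ n := by
      simpa using Finset.card_le_univ (D.support.toFinset ∪ C.support.toFinset)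
    have hUI := Finset.card_union_add_card_inter D.support.toFinset C.support.toFinset
    rw [cycle_support_card D hD, cycle_support_card C hC] at hUI
    omega
  · exfalso
    push Not at hdis
    obtain ⟨e0, he0D, he0C⟩ := hdis
    have hidx : ∀ e ∈ C.edges, ∃ i < C.length, e = s(C.getVert i, C.getVert (i + 1)) := by
      intro e
      induction e using Sym2.ind with
      | _ x y =>
        intro he
        rw [Walk.mk_mem_edges_iff_exists] at he
        obtain ⟨i, hi, h⟩ := he
        exact ⟨i, hi, h.symm⟩
    have hstep : ∀ i, i + 1 < C.length →
        (s(C.getVert i, C.getVert (i + 1)) ∈ D.edges ↔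
          s(C.getVert (i + 1), C.getVert (i + 2)) ∈ D.edges) := by
      intro i hi
      set x := C.getVert (i + 1) with hx
      have hxC : x ∈ C.support := C.getVert_mem_support _
      let S : Fin n → Prop := fun y => H.Reachable x y
      have hSx : S x := SimpleGraph.Reachable.refl x
      have hSC : ∀ y ∈ C.support, S y → y = x := fun y hy hS => (hno x y hxC hy hS).symm
      have hinj : ∀ k, k ≤ C.length → C.getVert k = x → k = i + 1 := by
        intro k hk hkx
        rcases Nat.eq_zero_or_pos k with rfl | hk0
        · rw [Walk.getVert_zero] at hkx
          have : C.getVert C.length = C.getVert (i + 1) := by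
            rw [Walk.getVert_length]; exact hkx
          have := hC.getVert_injOn (x₁ := C.length) (x₂ := i + 1)
            (by simp; omega) (by simp; omega) this
          omega
        · exact hC.getVert_injOn (by simp; omega) (by simp; omega) (hkx.trans hx)
      have hne1 : C.getVert i ≠ x := fun h => by have := hinj i (by omega) h; omega
      have hne2 : C.getVert (i + 2) ≠ x := fun h => by have := hinj (i+2) (by omega) h; omega
      have hcr1 : CrossesCut S s(C.getVert i, x) :=
        (crossesCut_mk _ _ _).2 (Or.inr ⟨hSx, fun h => hne1 (hSC _ (C.getVert_mem_support _) h)⟩)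
      have hcr2 : CrossesCut S s(x, C.getVert (i + 2)) :=
        (crossesCut_mk _ _ _).2 (Or.inl ⟨hSx, fun h => hne2 (hSC _ (C.getVert_mem_support _) h)⟩)
      have hcr : ∀ e ∈ G.edgeSet, CrossesCut S e →
          e = s(C.getVert i, x) ∨ e = s(x, C.getVert (i + 2)) := by
        rintro e he ⟨y, z, rfl, hy, hz⟩
        have heC : s(y, z) ∈ C.edges := by
          by_contra hcon
          apply hz
          have hadj : H.Adj y z := by
            rw [hH, SimpleGraph.deleteEdges_adj]
            exact ⟨he, hcon⟩
          exact SimpleGraph.Reachable.trans hy hadj.reachable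
        have hyx := hSC y (C.fst_mem_support_of_mem_edges heC) hy
        subst hyx
        obtain ⟨k, hk, hke⟩ := hidx _ heC
        rw [Sym2.eq_iff] at hke
        rcases hke with ⟨h1, h2⟩ | ⟨h1, h2⟩
        · have := hinj k hk.le h1.symm
          subst this
          right; rw [h2]
        · have := hinj (k+1) (by omega) h1.symm
          have : k = i := by omega
          subst this
          left; rw [h2]; exact Sym2.eq_swap
      have hev := (even_crossings_iff S D).2 Iff.rfl
      have key : ∀ e f : Sym2 (Fin n), e ∈ D.edges → f ∉ D.edges → CrossesCut S e →
          (∀ g ∈ G.edgeSet, CrossesCut S g → g = e ∨ g = f) → False := by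
        intro e f he hf hce hg
        have h1 : D.edges.countP (fun e => decide (CrossesCut S e)) = D.edges.count e := by
          rw [List.count]
          apply List.countP_congr
          intro g hgD
          simp only [decide_eq_true_eq, beq_iff_eq]
          constructor
          · intro hc
            rcases hg g (D.edges_subset_edgeSet hgD) hc with h | h
            · exact h
            · exact absurd (h ▸ hgD) hf
          · rintro rfl; exact hce
        rw [h1, List.count_eq_one_of_mem hD.isTrail.edges_nodup he] at hev
        exact absurd hev (by decide)
      constructor
      · intro h
        by_contra hcon
        exact key _ _ h hcon hcr1 hcr
      · intro h
        by_contra hcon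
        exact key _ _ h hcon hcr2 (fun g h1 h2 => (hcr g h1 h2).symm)
    have hall0 : ∀ i, i < C.length → (s(C.getVert i, C.getVert (i + 1)) ∈ D.edges ↔
        s(C.getVert 0, C.getVert 1) ∈ D.edges) := by
      intro i
      induction i with
      | zero => intro _; rfl
      | succ k ih =>
        intro hk
        rw [← ih (by omega)]
        exact (hstep k hk).symm
    have hsub : C.edges ⊆ D.edges := by
      intro e he
      obtain ⟨i, hi, rfl⟩ := hidx e he
      obtain ⟨j, hj, rfl⟩ := hidx e0 he0C
      exact (hall0 i hi).2 ((hall0 j hj).1 he0D)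
    have := length_le_of_edges_subset C hC.isTrail D.edges hsub
    rw [Walk.length_edges] at this
    omega

theorem cycle_lengths_bddAbove {n : ℕ} (G : SimpleGraph (Fin n)) :
    BddAbove {k : ℕ | ∃ (a : Fin n) (w : G.Walk a a), w.IsCycle ∧ w.length = k} := by
  classical
  refine ⟨n, ?_⟩
  rintro k ⟨a, w, hw, rfl⟩
  rw [← cycle_support_card w hw]
  simpa using Finset.card_le_univ w.support.toFinset

/-- A path `0, 1, …, n-1` with two chords `{0, p}` and `{q, r}`. -/
def earGraph (n p q r : ℕ) : SimpleGraph (Fin n) :=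
  SimpleGraph.fromRel (fun i j => i.val + 1 = j.val ∨ (i.val = 0 ∧ j.val = p) ∨
    (i.val = q ∧ j.val = r))

/-- The allowed edges, as unordered pairs of naturals. -/
def EarEdge (n p q r : ℕ) (e : Sym2 ℕ) : Prop :=
  (∃ k, k + 1 < n ∧ e = s(k, k + 1)) ∨ e = s(0, p) ∨ (q ≠ r ∧ e = s(q, r))

open Classical in
theorem ear_countP (n p q r k : ℕ) (hp : 2 ≤ p) (hqr : q = r ∨ (q + 2 ≤ r ∧ q ≤ p ∧ p < r))
    (L : List (Sym2 ℕ)) (hL : ∀ e ∈ L, EarEdge n p q r e) :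
    L.countP (fun e => decide (CrossesCut (fun i => i ≤ k) e)) =
      L.count s(k, k + 1) + (if k < p then L.count s(0, p) else 0) +
        (if q ≤ k ∧ k < r then L.count s(q, r) else 0) := by
  induction L with
  | nil => simp
  | cons e L ih =>
    have ih := ih (fun e he => hL e (List.mem_cons_of_mem _ he))
    rw [List.countP_cons, List.count_cons, List.count_cons, List.count_cons, ih]
    rcases hL e List.mem_cons_self with ⟨j, hj, rfl⟩ | rfl | ⟨hne, rfl⟩ <;>
    simp only [crossesCut_mk, decide_eq_true_eq, beq_iff_eq, Sym2.eq_iff] <;>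
    split_ifs <;> first | omega | grind

theorem ear_length (n p q r : ℕ) (hp : 2 ≤ p) (hqr : q = r ∨ (q + 2 ≤ r ∧ q ≤ p ∧ p < r))
    (L : List (Sym2 ℕ)) (hL : ∀ e ∈ L, EarEdge n p q r e) :
    L.length = ∑ k ∈ Finset.range n, L.count s(k, k + 1) + L.count s(0, p) + L.count s(q, r) := by
  induction L with
  | nil => simp
  | cons e L ih =>
    have ih := ih (fun e he => hL e (List.mem_cons_of_mem _ he))
    have hs : ∑ k ∈ Finset.range n, (e :: L).count s(k, k + 1) =
        ∑ k ∈ Finset.range n, L.count s(k, k + 1) +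
        ∑ k ∈ Finset.range n, (if e = s(k, k + 1) then 1 else 0) := by
      rw [← Finset.sum_add_distrib]
      apply Finset.sum_congr rfl
      intro k _
      rw [List.count_cons]
      simp only [beq_iff_eq]
    rw [List.length_cons, hs, List.count_cons, List.count_cons, ih]
    simp only [beq_iff_eq]
    rcases hL e List.mem_cons_self with ⟨j, hj, rfl⟩ | rfl | ⟨hne, rfl⟩
    · have h1 : ∀ k, (s(j, j + 1) = s(k, k + 1)) ↔ j = k := by
        intro k; rw [Sym2.eq_iff]; grind
      simp only [h1, Finset.sum_ite_eq, Finset.mem_range, Sym2.eq_iff]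
      split_ifs <;> first | omega | grind
    · have h1 : ∀ k, (s(0, p) = s(k, k + 1)) ↔ False := by
        intro k; rw [Sym2.eq_iff]; grind
      simp only [h1, if_false, Finset.sum_const_zero, Sym2.eq_iff]
      split_ifs <;> first | omega | grind
    · have h1 : ∀ k, (s(q, r) = s(k, k + 1)) ↔ False := by
        intro k; rw [Sym2.eq_iff]; grind
      simp only [h1, if_false, Finset.sum_const_zero, Sym2.eq_iff]
      split_ifs <;> first | omega | grind

theorem sum_indicator (n a b : ℕ) (hb : b ≤ n) :
    ∑ k ∈ Finset.range n, (if a ≤ k ∧ k < b then 1 else 0) = b - a := by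
  rw [← Finset.card_filter, ← Nat.card_Ico]
  congr 1
  ext k
  simp only [Finset.mem_filter, Finset.mem_range, Finset.mem_Ico]
  omega

theorem ear_cycle_length (n p q r : ℕ) (hp : 2 ≤ p) (hpn : p < n) (hrn : r < n)
    (hqr : q = r ∨ (q + 2 ≤ r ∧ q ≤ p ∧ p < r)) {a : Fin n}
    (w : (earGraph n p q r).Walk a a) (hw : w.IsCycle) :
    w.length = p + 1 ∨ (q ≠ r ∧ (w.length = r - q + 1 ∨ w.length = q + (r - p) + 2)) := by
  classical
  set L := w.edges.map (Sym2.map Fin.val) with hLdef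
  have hnd : L.Nodup := hw.isTrail.edges_nodup.map (Sym2.map.injective Fin.val_injective)
  have hlen : L.length = w.length := by simp [hLdef]
  have hL : ∀ e ∈ L, EarEdge n p q r e := by
    intro e he
    rw [hLdef, List.mem_map] at he
    obtain ⟨e', he', rfl⟩ := he
    have := w.edges_subset_edgeSet he'
    induction e' using Sym2.ind with
    | _ x y =>
      rw [SimpleGraph.mem_edgeSet, earGraph, SimpleGraph.fromRel_adj] at this
      obtain ⟨hne, h⟩ := this
      have hne' : x.val ≠ y.val := fun h => hne (Fin.ext h)
      have hx := x.isLt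
      have hy := y.isLt
      rw [Sym2.map_mk]
      unfold EarEdge
      rcases h with (h | ⟨h, h'⟩ | ⟨h, h'⟩) | (h | ⟨h, h'⟩ | ⟨h, h'⟩)
      · exact Or.inl ⟨x.val, by omega, by simp [h]⟩
      · right; left; simp [h, h']
      · right; right; exact ⟨by omega, by simp [h, h']⟩
      · exact Or.inl ⟨y.val, by omega, by simp [h]⟩
      · right; left; simp [h, h']
      · right; right; exact ⟨by omega, by simp [h, h']⟩
  have hpar : ∀ k, Even (L.count s(k, k + 1) + (if k < p then L.count s(0, p) else 0) +
        (if q ≤ k ∧ k < r then L.count s(q, r) else 0)) := by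
    intro k
    rw [← ear_countP n p q r k hp hqr L hL]
    have h := (even_crossings_iff (fun i : Fin n => i.val ≤ k) w).2 Iff.rfl
    rw [hLdef, List.countP_map]
    convert h using 2
    funext e
    induction e using Sym2.ind with
    | _ x y => simp [crossesCut_mk]
  have hX : ∀ k, L.count s(k, k + 1) ≤ 1 := fun k => List.nodup_iff_count_le_one.1 hnd _
  have hY : L.count s(0, p) ≤ 1 := List.nodup_iff_count_le_one.1 hnd _
  have hZ : L.count s(q, r) ≤ 1 := List.nodup_iff_count_le_one.1 hnd _
  have hZ0 : q = r → L.count s(q, r) = 0 := by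
    intro h
    rw [List.count_eq_zero]
    intro hm
    rcases hL _ hm with ⟨j, hj, h1⟩ | h1 | ⟨hne, -⟩
    · rw [Sym2.eq_iff] at h1; omega
    · rw [Sym2.eq_iff] at h1; omega
    · exact hne h
  have htot := ear_length n p q r hp hqr L hL
  rw [hlen] at htot
  have h3 := hw.three_le_length
  generalize L.count s(0, p) = Y at *
  generalize L.count s(q, r) = Z at *
  rcases Nat.le_one_iff_eq_zero_or_eq_one.1 hY with rfl | rfl <;>
  rcases Nat.le_one_iff_eq_zero_or_eq_one.1 hZ with rfl | rfl
  · exfalso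
    rw [Finset.sum_eq_zero] at htot
    · omega
    · intro k _
      have h1 := hpar k
      have h2 := hX k
      simp only [ite_self, Nat.even_iff] at h1
      omega
  · right
    have hne : q ≠ r := fun h => by have := hZ0 h; omega
    refine ⟨hne, Or.inl ?_⟩
    have : ∀ k ∈ Finset.range n, L.count s(k, k + 1) = if q ≤ k ∧ k < r then 1 else 0 := by
      intro k _
      have h1 := hpar k
      have h2 := hX k
      rw [Nat.even_iff] at h1
      split_ifs at h1 ⊢ <;> omega
    rw [Finset.sum_congr rfl this, sum_indicator n q r hrn.le] at htot
    omega
  · left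
    have : ∀ k ∈ Finset.range n, L.count s(k, k + 1) = if 0 ≤ k ∧ k < p then 1 else 0 := by
      intro k _
      have h1 := hpar k
      have h2 := hX k
      rw [Nat.even_iff] at h1
      split_ifs at h1 ⊢ <;> omega
    rw [Finset.sum_congr rfl this, sum_indicator n 0 p hpn.le] at htot
    omega
  · right
    have hne : q ≠ r := fun h => by have := hZ0 h; omega
    refine ⟨hne, Or.inr ?_⟩
    have : ∀ k ∈ Finset.range n, L.count s(k, k + 1) =
        (if 0 ≤ k ∧ k < q then 1 else 0) + (if p ≤ k ∧ k < r then 1 else 0) := by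
      intro k _
      have h1 := hpar k
      have h2 := hX k
      rw [Nat.even_iff] at h1
      split_ifs at h1 ⊢ <;> omega
    rw [Finset.sum_congr rfl this, Finset.sum_add_distrib, sum_indicator n 0 q (by omega),
      sum_indicator n p r hrn.le] at htot
    omega

theorem exists_segment {n : ℕ} (G : SimpleGraph (Fin n))
    (hG : ∀ i j : Fin n, i.val + 1 = j.val → G.Adj i j) (d : ℕ) :
    ∀ i j : Fin n, i.val + d = j.val → ∃ w : G.Walk i j, w.IsPath ∧ w.length = d ∧
      (∀ x ∈ w.support, i.val ≤ x.val) ∧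
      (∀ x y, s(x, y) ∈ w.edges → x.val + 1 = y.val ∨ y.val + 1 = x.val) := by
  induction d with
  | zero =>
    intro i j h
    obtain rfl : i = j := Fin.ext (by omega)
    exact ⟨Walk.nil, by simp⟩
  | succ d ih =>
    intro i j h
    have hj := j.isLt
    let m : Fin n := ⟨i.val + 1, by omega⟩
    have hm : m.val = i.val + 1 := rfl
    obtain ⟨w, h1, h2, h3, h4⟩ := ih m j (by omega)
    have hadj : G.Adj i m := hG i m rfl
    refine ⟨Walk.cons hadj w, ?_, by simp [h2], ?_, ?_⟩
    · rw [Walk.cons_isPath_iff]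
      refine ⟨h1, fun hi => ?_⟩
      have := h3 i hi
      omega
    · intro x hx
      rw [Walk.support_cons, List.mem_cons] at hx
      rcases hx with rfl | hx
      · exact le_rfl
      · have := h3 x hx; omega
    · intro x y hxy
      rw [Walk.edges_cons, List.mem_cons] at hxy
      rcases hxy with hxy | hxy
      · rw [Sym2.eq_iff] at hxy
        rcases hxy with ⟨rfl, rfl⟩ | ⟨rfl, rfl⟩ <;> omega
      · exact h4 x y hxy

theorem exists_chord_cycle {n : ℕ} (G : SimpleGraph (Fin n))
    (hG : ∀ i j : Fin n, i.val + 1 = j.val → G.Adj i j) (i j : Fin n)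
    (hij : i.val + 2 ≤ j.val) (hadj : G.Adj i j) :
    ∃ (a : Fin n) (w : G.Walk a a), w.IsCycle ∧ w.length = j.val - i.val + 1 := by
  obtain ⟨w, h1, h2, h3, h4⟩ := exists_segment G hG (j.val - i.val) i j (by omega)
  refine ⟨j, Walk.cons hadj.symm w, ?_, by simp [h2]⟩
  rw [Walk.cons_isCycle_iff]
  refine ⟨h1, fun h => ?_⟩
  have := h4 _ _ h
  omega

theorem segment_connected {n : ℕ} (hn : 0 < n) (G : SimpleGraph (Fin n))
    (hG : ∀ i j : Fin n, i.val + 1 = j.val → G.Adj i j) : G.Connected := by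
  have h0 : ∀ j : Fin n, G.Reachable ⟨0, hn⟩ j := by
    intro j
    obtain ⟨w, -⟩ := exists_segment G hG j.val ⟨0, hn⟩ j (by simp)
    exact w.reachable
  have : Nonempty (Fin n) := ⟨⟨0, hn⟩⟩
  exact SimpleGraph.Connected.mk (fun x y => (h0 x).symm.trans (h0 y))

theorem memGclass_of_lengths (g c : ℕ) {n : ℕ} (G : SimpleGraph (Fin n)) (hconn : G.Connected)
    (hg : ∃ (a : Fin n) (w : G.Walk a a), w.IsCycle ∧ w.length = g)
    (hc : ∃ (a : Fin n) (w : G.Walk a a), w.IsCycle ∧ w.length = c)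
    (hall : ∀ (a : Fin n) (w : G.Walk a a), w.IsCycle → g ≤ w.length ∧ w.length ≤ c) :
    memGclass g c G := by
  refine ⟨hconn, ?_, ?_⟩
  · obtain ⟨a, w, hw, hl⟩ := hg
    have h1 := girth_le_length hw
    have hnac : ¬ G.IsAcyclic := fun h => h w hw
    obtain ⟨b, w', hw', hl'⟩ := exists_girth_eq_length.2 hnac
    have := (hall b w' hw').1
    omega
  · apply le_antisymm
    · apply csSup_le
      · obtain ⟨a, w, hw, hl⟩ := hc
        exact ⟨c, a, w, hw, hl⟩
      · rintro k ⟨a, w, hw, rfl⟩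
        exact (hall a w hw).2
    · exact le_csSup (cycle_lengths_bddAbove G) hc

theorem backward_exists (g c n : ℕ) (h3 : 3 ≤ g) (hcn : c ≤ n)
    (h : g = c ∨ (g < c ∧ 2 * g + c ≤ 2 * n + 2)) :
    ∃ G : SimpleGraph (Fin n), memGclass g c G := by
  have hadj : ∀ p q r, ∀ i j : Fin n, i.val + 1 = j.val → (earGraph n p q r).Adj i j := by
    intro p q r i j hij
    rw [earGraph, SimpleGraph.fromRel_adj]
    exact ⟨fun h => by subst h; omega, Or.inl (Or.inl hij)⟩
  have hc1 : ∀ p q r, 2 ≤ p → p < n → ∃ (a : Fin n) (w : (earGraph n p q r).Walk a a),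
      w.IsCycle ∧ w.length = p + 1 := by
    intro p q r hp hpn
    have := exists_chord_cycle (earGraph n p q r) (hadj p q r) ⟨0, by omega⟩ ⟨p, hpn⟩
      (by simpa using hp) (by
        rw [earGraph, SimpleGraph.fromRel_adj]
        exact ⟨fun h => by simp at h; omega, Or.inl (Or.inr (Or.inl ⟨rfl, rfl⟩))⟩)
    simpa using this
  have hc2 : ∀ p q r, q + 2 ≤ r → r < n → ∃ (a : Fin n) (w : (earGraph n p q r).Walk a a),
      w.IsCycle ∧ w.length = r - q + 1 := by
    intro p q r hp hpn
    have := exists_chord_cycle (earGraph n p q r) (hadj p q r) ⟨q, by omega⟩ ⟨r, hpn⟩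
      (by simpa using hp) (by
        rw [earGraph, SimpleGraph.fromRel_adj]
        exact ⟨fun h => by simp at h; omega, Or.inl (Or.inr (Or.inr ⟨rfl, rfl⟩))⟩)
    simpa using this
  rcases h with rfl | ⟨hlt, hn⟩
  · refine ⟨earGraph n (g - 1) 0 0, memGclass_of_lengths g g _
      (segment_connected (by omega) _ (hadj _ _ _)) ?_ ?_ ?_⟩
    · have := hc1 (g - 1) 0 0 (by omega) (by omega)
      rwa [show g - 1 + 1 = g by omega] at this
    · have := hc1 (g - 1) 0 0 (by omega) (by omega)
      rwa [show g - 1 + 1 = g by omega] at this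
    · intro a w hw
      have := ear_cycle_length n (g - 1) 0 0 (by omega) (by omega) (by omega) (Or.inl rfl) w hw
      omega
  · obtain ⟨q, hq⟩ : ∃ q, q = g - 1 - c / 2 := ⟨_, rfl⟩
    refine ⟨earGraph n (g - 1) q (c + q - 1), memGclass_of_lengths g c _
      (segment_connected (by omega) _ (hadj _ _ _)) ?_ ?_ ?_⟩
    · have := hc1 (g - 1) q (c + q - 1) (by omega) (by omega)
      rwa [show g - 1 + 1 = g by omega] at this
    · have := hc2 (g - 1) q (c + q - 1) (by omega) (by omega)
      rwa [show c + q - 1 - q + 1 = c by omega] at this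
    · intro a w hw
      have := ear_cycle_length n (g - 1) q (c + q - 1) (by omega) (by omega) (by omega)
        (Or.inr (by omega)) w hw
      omega

theorem forward_bound (g c n : ℕ) (h3 : 3 ≤ g) (hgc : g < c) (G : SimpleGraph (Fin n))
    (hG : memGclass g c G) : 2 * g + c ≤ 2 * n + 2 := by
  obtain ⟨-, hg, hc⟩ := hG
  have hnac : ¬ G.IsAcyclic := by
    rw [← girth_eq_zero]; omega
  obtain ⟨b, D, hD, hDl⟩ := exists_girth_eq_length.2 hnac
  have hmem := Nat.sSup_mem (s := {k : ℕ | ∃ (a : Fin n) (w : G.Walk a a), w.IsCycle ∧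
    w.length = k}) ⟨_, b, D, hD, rfl⟩ (cycle_lengths_bddAbove G)
  change circumference G ∈ _ at hmem
  rw [hc] at hmem
  obtain ⟨a, C, hC, hCl⟩ := hmem
  by_cases hear : ∃ u v, u ∈ C.support ∧ v ∈ C.support ∧ u ≠ v ∧
      (G.deleteEdges {e | e ∈ C.edges}).Reachable u v
  · have := forward_ear C hC hear
    omega
  · have := forward_noear C hC D hD (by omega) (by
      intro u v hu hv hr
      by_contra hne
      exact hear ⟨u, v, hu, hv, hne, hr⟩)
    omega

/-- Lemma (lem2): The triplet `(g,c,n)` is v-admissible if and only if either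
`g = c ≤ n`, or `g < c` and `n ≥ g - 1 + c/2`. -/
theorem vAdmissible_iff (g c n : ℕ) (h3 : 3 ≤ g) (hgc : g ≤ c) (hcn : c ≤ n) :
    (∃ G : SimpleGraph (Fin n), memGclass g c G) ↔
    (g = c ∨ (g < c ∧ (g : ℝ) - 1 + (c : ℝ) / 2 ≤ (n : ℝ))) := by
  constructor
  · rintro ⟨G, hG⟩
    rcases Nat.eq_or_lt_of_le hgc with h | h
    · exact Or.inl h
    · right
      refine ⟨h, ?_⟩
      have h1 : ((2 * g + c : ℕ) : ℝ) ≤ ((2 * n + 2 : ℕ) : ℝ) :=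
        Nat.cast_le.2 (forward_bound g c n h3 h G hG)
      push_cast at h1
      linarith
  · intro h
    apply backward_exists g c n h3 hcn
    rcases h with h | ⟨h, h1⟩
    · exact Or.inl h
    · right
      refine ⟨h, ?_⟩
      have h2 : ((2 * g + c : ℕ) : ℝ) ≤ ((2 * n + 2 : ℕ) : ℝ) := by
        push_cast
        linarith
      exact Nat.cast_le.1 h2
end

section
/- If (g,c,n) is a v-admissible triplet and n' is an integer with n' ≥ n, then (g,c,n') is a v-admissible triplet and A(g,c,n') ≤ A(g,c,n) ≤ B(g,c,n) ≤ B(g,c,n'). -/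
open SimpleGraph Set

/-! ### Abstract part: geodesics in an `ℓ¹` product -/

section AbstractPart

variable {X Y : Type} (d : X → X → ℝ) (e : Y → Y → ℝ) (r : Y → X) (h : Y → ℝ) (v : X)

/-- Pseudometric axioms for a real-valued function. -/
structure PM {X : Type} (d : X → X → ℝ) : Prop where
  self : ∀ x, d x x = 0
  nonneg : ∀ x y, 0 ≤ d x y
  symm : ∀ x y, d x y = d y x
  tri : ∀ x y z, d x z ≤ d x y + d y z

/-- `Y` sits in `X × ℝ` with the `ℓ¹` metric, all positive heights over `v`. -/
structure Emb {X Y : Type} (d : X → X → ℝ) (e : Y → Y → ℝ) (r : Y → X) (h : Y → ℝ) (v : X) :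
    Prop where
  pm : PM d
  form : ∀ p q, e p q = d (r p) (r q) + |h p - h q|
  hnn : ∀ p, 0 ≤ h p
  base : ∀ p, 0 < h p → r p = v

/-- Geodesic for an abstract distance. -/
def AGeo {Y : Type} (e : Y → Y → ℝ) (a b : ℝ) (γ : ℝ → Y) : Prop :=
  a ≤ b ∧ ∀ s ∈ Set.Icc a b, ∀ t ∈ Set.Icc a b, e (γ s) (γ t) = |s - t|

variable {d e r h v}

lemma AGeo.split (E : Emb d e r h v) {a b : ℝ} {γ : ℝ → Y} (hg : AGeo e a b γ)
    {s t u : ℝ} (h1 : a ≤ s) (h2 : s ≤ t) (h3 : t ≤ u) (h4 : u ≤ b) :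
    d (r (γ s)) (r (γ u)) = d (r (γ s)) (r (γ t)) + d (r (γ t)) (r (γ u)) ∧
    |h (γ s) - h (γ u)| = |h (γ s) - h (γ t)| + |h (γ t) - h (γ u)| := by
  have hs : s ∈ Set.Icc a b := ⟨h1, by linarith⟩
  have ht : t ∈ Set.Icc a b := ⟨by linarith, by linarith⟩
  have hu : u ∈ Set.Icc a b := ⟨by linarith, by linarith⟩
  have e1 := hg.2 s hs t ht
  have e2 := hg.2 t ht u hu
  have e3 := hg.2 s hs u hu
  rw [E.form, abs_of_nonpos (by linarith : s - t ≤ 0)] at e1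
  rw [E.form, abs_of_nonpos (by linarith : t - u ≤ 0)] at e2
  rw [E.form, abs_of_nonpos (by linarith : s - u ≤ 0)] at e3
  have t1 := E.pm.tri (r (γ s)) (r (γ t)) (r (γ u))
  have t2 := abs_sub_le (h (γ s)) (h (γ t)) (h (γ u))
  constructor <;> linarith

lemma AGeo.between (E : Emb d e r h v) {a b : ℝ} {γ : ℝ → Y} (hg : AGeo e a b γ)
    {s t u : ℝ} (h1 : a ≤ s) (h2 : s ≤ t) (h3 : t ≤ u) (h4 : u ≤ b) :
    (h (γ s) ≤ h (γ t) ∧ h (γ t) ≤ h (γ u)) ∨ (h (γ u) ≤ h (γ t) ∧ h (γ t) ≤ h (γ s)) := by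
  have := (hg.split E h1 h2 h3 h4).2
  rcases abs_cases (h (γ s) - h (γ u)) with ⟨a1, b1⟩ | ⟨a1, b1⟩ <;>
  rcases abs_cases (h (γ s) - h (γ t)) with ⟨a2, b2⟩ | ⟨a2, b2⟩ <;>
  rcases abs_cases (h (γ t) - h (γ u)) with ⟨a3, b3⟩ | ⟨a3, b3⟩ <;>
  first
    | (left; constructor <;> linarith)
    | (right; constructor <;> linarith)

lemma contOn_of_lip {f : ℝ → ℝ} {a b : ℝ}
    (hf : ∀ s ∈ Set.Icc a b, ∀ t ∈ Set.Icc a b, |f s - f t| ≤ |s - t|) :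
    ContinuousOn f (Set.Icc a b) := by
  have : LipschitzOnWith 1 f (Set.Icc a b) := by
    apply LipschitzOnWith.of_dist_le_mul
    intro s hs t ht
    simpa [Real.dist_eq] using hf s hs t ht
  exact this.continuousOn

lemma AGeo.contH (E : Emb d e r h v) {a b : ℝ} {γ : ℝ → Y} (hg : AGeo e a b γ) :
    ContinuousOn (fun s => h (γ s)) (Set.Icc a b) := by
  apply contOn_of_lip
  intro s hs t ht
  rw [← hg.2 s hs t ht, E.form]
  linarith [E.pm.nonneg (r (γ s)) (r (γ t))]

/-- Every height between the heights of the two ends is attained. -/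
lemma AGeo.ivt (E : Emb d e r h v) {a b : ℝ} {γ : ℝ → Y} (hg : AGeo e a b γ) {η : ℝ}
    (hη : (h (γ a) ≤ η ∧ η ≤ h (γ b)) ∨ (h (γ b) ≤ η ∧ η ≤ h (γ a))) :
    ∃ t ∈ Set.Icc a b, h (γ t) = η := by
  rcases hη with hη | hη
  · obtain ⟨t, ht, h'⟩ := intermediate_value_Icc hg.1 (hg.contH E) hη
    exact ⟨t, ht, h'⟩
  · obtain ⟨t, ht, h'⟩ := intermediate_value_Icc' hg.1 (hg.contH E) hη
    exact ⟨t, ht, h'⟩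

/-- A geodesic going from positive height to height zero passes through `v`. -/
lemma AGeo.hit (E : Emb d e r h v) {a b : ℝ} {γ : ℝ → Y} (hg : AGeo e a b γ) {s t : ℝ}
    (hs : s ∈ Set.Icc a b) (ht : t ∈ Set.Icc a b) (h0 : 0 < h (γ s)) (h1 : h (γ t) = 0) :
    ∃ u ∈ Set.Icc a b, h (γ u) = 0 ∧ d v (r (γ u)) = 0 := by
  have est := hg.2 s hs t ht
  rw [E.form, h1, sub_zero, abs_of_pos h0, E.base _ h0] at est
  have hd := E.pm.nonneg v (r (γ t))
  rcases le_total s t with hst | hst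
  · rw [abs_of_nonpos (by linarith)] at est
    have hu : s + h (γ s) ∈ Set.Icc a b := ⟨by linarith [hs.1], by linarith [ht.2]⟩
    refine ⟨s + h (γ s), hu, ?_⟩
    have e2 := hg.2 s hs _ hu
    have e3 := hg.between E hs.1 (t := s + h (γ s)) (u := t) (by linarith) (by linarith) ht.2
    have hn := E.hnn (γ (s + h (γ s)))
    have hle : h (γ (s + h (γ s))) ≤ h (γ s) := by rcases e3 with e3 | e3 <;> linarith
    rw [E.form, E.base _ h0, abs_of_nonneg (by linarith), abs_of_nonpos (by linarith)] at e2
    by_cases hz : 0 < h (γ (s + h (γ s)))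
    · rw [E.base _ hz, E.pm.self] at e2
      linarith
    · have : h (γ (s + h (γ s))) = 0 := by linarith
      refine ⟨this, by linarith⟩
  · rw [abs_of_nonneg (by linarith)] at est
    have hu : s - h (γ s) ∈ Set.Icc a b := ⟨by linarith [ht.1], by linarith [hs.2]⟩
    refine ⟨s - h (γ s), hu, ?_⟩
    have e2 := hg.2 s hs _ hu
    have e3 := hg.between E ht.1 (t := s - h (γ s)) (u := s) (by linarith) (by linarith) hs.2
    have hn := E.hnn (γ (s - h (γ s)))
    have hle : h (γ (s - h (γ s))) ≤ h (γ s) := by rcases e3 with e3 | e3 <;> linarith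
    rw [E.form, E.base _ h0, abs_of_nonneg (by linarith), abs_of_nonneg (by linarith)] at e2
    by_cases hz : 0 < h (γ (s - h (γ s)))
    · rw [E.base _ hz, E.pm.self] at e2
      linarith
    · have : h (γ (s - h (γ s))) = 0 := by linarith
      refine ⟨this, by linarith⟩

/-- The projection of a geodesic is a geodesic up to reparametrization. -/
lemma AGeo.proj (E : Emb d e r h v) {a b : ℝ} {γ : ℝ → Y} (hg : AGeo e a b γ) :
    ∃ (L : ℝ) (β : ℝ → X), AGeo d 0 L β ∧
      (∀ s ∈ Set.Icc a b, ∃ u ∈ Set.Icc 0 L, d (r (γ s)) (β u) = 0) ∧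
      (∀ u ∈ Set.Icc 0 L, ∃ s ∈ Set.Icc a b, β u = r (γ s)) ∧
      d (r (γ a)) (β 0) = 0 ∧ d (r (γ b)) (β L) = 0 := by
  set k : ℝ → ℝ := fun s => d (r (γ a)) (r (γ s)) with hk
  have ka : k a = 0 := E.pm.self _
  have kd : ∀ s ∈ Set.Icc a b, ∀ t ∈ Set.Icc a b, d (r (γ s)) (r (γ t)) = |k s - k t| := by
    have aux : ∀ s ∈ Set.Icc a b, ∀ t ∈ Set.Icc a b, s ≤ t →
        d (r (γ s)) (r (γ t)) = |k s - k t| := by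
      intro s hs t ht hst
      have := (hg.split E le_rfl hs.1 hst ht.2).1
      have hn := E.pm.nonneg (r (γ s)) (r (γ t))
      simp only [hk]
      rw [this, abs_of_nonpos (by linarith)]
      ring
    intro s hs t ht
    rcases le_total s t with hst | hst
    · exact aux s hs t ht hst
    · rw [E.pm.symm, aux t ht s hs hst, abs_sub_comm]
  have kc : ContinuousOn k (Set.Icc a b) := by
    apply contOn_of_lip
    intro s hs t ht
    rw [← hg.2 s hs t ht, E.form, kd s hs t ht]
    linarith [abs_nonneg (h (γ s) - h (γ t))]
  have ha : a ∈ Set.Icc a b := ⟨le_rfl, hg.1⟩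
  have hb : b ∈ Set.Icc a b := ⟨hg.1, le_rfl⟩
  have kr : ∀ s ∈ Set.Icc a b, k s ∈ Set.Icc 0 (k b) := by
    intro s hs
    refine ⟨E.pm.nonneg _ _, ?_⟩
    have := (hg.split E le_rfl hs.1 hs.2 le_rfl).1
    have hn := E.pm.nonneg (r (γ s)) (r (γ b))
    simp only [hk]
    linarith
  have ex : ∀ u : ℝ, ∃ s, u ∈ Set.Icc 0 (k b) → s ∈ Set.Icc a b ∧ k s = u := by
    intro u
    by_cases hu : u ∈ Set.Icc 0 (k b)
    · rw [← ka] at hu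
      obtain ⟨s, hs, hs'⟩ := intermediate_value_Icc hg.1 kc hu
      exact ⟨s, fun _ => ⟨hs, hs'⟩⟩
    · exact ⟨0, fun h => absurd h hu⟩
  choose σ hσ using ex
  have kb : 0 ≤ k b := (kr b hb).1
  have key : ∀ s ∈ Set.Icc a b, d (r (γ s)) (r (γ (σ (k s)))) = 0 := by
    intro s hs
    obtain ⟨h1, h2⟩ := hσ (k s) (kr s hs)
    rw [kd s hs _ h1, h2, sub_self, abs_zero]
  refine ⟨k b, fun u => r (γ (σ u)), ⟨kb, ?_⟩, ?_, ?_, ?_, ?_⟩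
  · intro s hs t ht
    rw [kd _ (hσ s hs).1 _ (hσ t ht).1, (hσ s hs).2, (hσ t ht).2]
  · intro s hs
    exact ⟨k s, kr s hs, key s hs⟩
  · intro u hu
    exact ⟨σ u, (hσ u hu).1, rfl⟩
  · have := key a ha
    rwa [ka] at this
  · exact key b hb

lemma Emb.zero (E : Emb d e r h v) {p q : Y} (h0 : e p q = 0) :
    d (r p) (r q) = 0 ∧ h p = h q := by
  rw [E.form] at h0
  have h1 := E.pm.nonneg (r p) (r q)
  have h2 := abs_nonneg (h p - h q)
  refine ⟨by linarith, ?_⟩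
  have : |h p - h q| = 0 := by linarith
  linarith [abs_eq_zero.1 this]

lemma thin_side (E : Emb d e r h v) {a1 b1 a2 b2 a3 b3 : ℝ} {g1 g2 g3 : ℝ → Y}
    (h1 : AGeo e a1 b1 g1) (h2 : AGeo e a2 b2 g2) (h3 : AGeo e a3 b3 g3)
    (k1 : e (g1 b1) (g2 a2) = 0) (k2 : e (g2 b2) (g3 a3) = 0) (k3 : e (g3 b3) (g1 a1) = 0)
    {D : ℝ} (hD : 0 ≤ D)
    (H : ∀ s ∈ Set.Icc a1 b1,
      (∃ t ∈ Set.Icc a2 b2, d (r (g1 s)) (r (g2 t)) ≤ D) ∨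
      (∃ t ∈ Set.Icc a3 b3, d (r (g1 s)) (r (g3 t)) ≤ D)) :
    ∀ s ∈ Set.Icc a1 b1,
      (∃ t ∈ Set.Icc a2 b2, e (g1 s) (g2 t) ≤ D) ∨
      (∃ t ∈ Set.Icc a3 b3, e (g1 s) (g3 t) ≤ D) := by
  intro s hs
  have z1 := (E.zero k1).2
  have z2 := (E.zero k2).2
  have z3 := (E.zero k3).2
  have bet := h1.between E le_rfl hs.1 hs.2 le_rfl
  have n1 := E.hnn (g1 a1)
  have n2 := E.hnn (g2 a2)
  have n3 := E.hnn (g3 a3)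
  by_cases hp : 0 < h (g1 s)
  · have fin : ∀ q, h q = h (g1 s) → e (g1 s) q ≤ D := by
      intro q hq
      rw [E.form, E.base _ hp, E.base q (by rw [hq]; exact hp), E.pm.self, hq]
      simpa using hD
    have alt : ((h (g2 a2) ≤ h (g1 s) ∧ h (g1 s) ≤ h (g2 b2)) ∨
        (h (g2 b2) ≤ h (g1 s) ∧ h (g1 s) ≤ h (g2 a2))) ∨
        ((h (g3 a3) ≤ h (g1 s) ∧ h (g1 s) ≤ h (g3 b3)) ∨
        (h (g3 b3) ≤ h (g1 s) ∧ h (g1 s) ≤ h (g3 a3))) := by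
      rw [← z1, z2, z3]
      rcases le_total (h (g3 a3)) (h (g1 s)) with hz | hz <;> rcases bet with bet | bet <;> tauto
    rcases alt with alt | alt
    · obtain ⟨t, ht, ht'⟩ := h2.ivt E alt
      exact Or.inl ⟨t, ht, fin _ ht'⟩
    · obtain ⟨t, ht, ht'⟩ := h3.ivt E alt
      exact Or.inr ⟨t, ht, fin _ ht'⟩
  · have hz : h (g1 s) = 0 := le_antisymm (not_lt.1 hp) (E.hnn _)
    have A2 : a2 ∈ Set.Icc a2 b2 := ⟨le_rfl, h2.1⟩
    have B2 : b2 ∈ Set.Icc a2 b2 := ⟨h2.1, le_rfl⟩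
    have A3 : a3 ∈ Set.Icc a3 b3 := ⟨le_rfl, h3.1⟩
    have B3 : b3 ∈ Set.Icc a3 b3 := ⟨h3.1, le_rfl⟩
    have fin0 : ∀ q, h q = 0 → d (r (g1 s)) (r q) ≤ D → e (g1 s) q ≤ D := by
      intro q hq hq'
      rw [E.form, hz, hq]
      simpa using hq'
    have fin : ∀ q, h q = 0 → d v (r q) = 0 → d (r (g1 s)) v ≤ D → e (g1 s) q ≤ D := by
      intro q hq hq' hv
      apply fin0 q hq
      linarith [E.pm.tri (r (g1 s)) v (r q)]
    have hit2 : ∀ t ∈ Set.Icc a2 b2, 0 < h (g2 t) → ∀ t' ∈ Set.Icc a2 b2, h (g2 t') = 0 →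
        d (r (g1 s)) v ≤ D → ∃ t ∈ Set.Icc a2 b2, e (g1 s) (g2 t) ≤ D := by
      intro t ht p t' ht' p' hv
      obtain ⟨u, hu, q, q'⟩ := h2.hit E ht ht' p p'
      exact ⟨u, hu, fin _ q q' hv⟩
    have hit3 : ∀ t ∈ Set.Icc a3 b3, 0 < h (g3 t) → ∀ t' ∈ Set.Icc a3 b3, h (g3 t') = 0 →
        d (r (g1 s)) v ≤ D → ∃ t ∈ Set.Icc a3 b3, e (g1 s) (g3 t) ≤ D := by
      intro t ht p t' ht' p' hv
      obtain ⟨u, hu, q, q'⟩ := h3.hit E ht ht' p p'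
      exact ⟨u, hu, fin _ q q' hv⟩
    have ends : h (g3 b3) = 0 ∨ h (g2 a2) = 0 := by
      rw [z3, ← z1]
      have m1 := E.hnn (g1 b1)
      rcases bet with bet | bet
      · left; linarith
      · right; linarith
    rcases H s hs with ⟨t, ht, hd⟩ | ⟨t, ht, hd⟩
    · rcases (E.hnn (g2 t)).eq_or_lt with p | p
      · exact Or.inl ⟨t, ht, fin0 _ p.symm hd⟩
      · have hv : d (r (g1 s)) v ≤ D := by rwa [E.base _ p] at hd
        rcases n3.eq_or_lt with q | q
        · exact Or.inl (hit2 t ht p b2 B2 (by rw [z2]; exact q.symm) hv)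
        · rcases ends with w | w
          · exact Or.inr (hit3 a3 A3 q b3 B3 w hv)
          · exact Or.inl (hit2 t ht p a2 A2 w hv)
    · rcases (E.hnn (g3 t)).eq_or_lt with p | p
      · exact Or.inr ⟨t, ht, fin0 _ p.symm hd⟩
      · have hv : d (r (g1 s)) v ≤ D := by rwa [E.base _ p] at hd
        rcases n3.eq_or_lt with q | q
        · exact Or.inr (hit3 t ht p a3 A3 q.symm hv)
        · rcases ends with w | w
          · exact Or.inr (hit3 t ht p b3 B3 w hv)
          · exact Or.inl (hit2 b2 B2 (by rw [z2]; exact q) a2 A2 w hv)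

/-- Transfer of closeness from reparametrized projections to projections. -/
lemma near_transfer (E : Emb d e r h v) {a1 b1 a2 b2 a3 b3 L1 L2 L3 : ℝ} {g1 g2 g3 : ℝ → Y}
    {β1 β2 β3 : ℝ → X}
    (p1 : ∀ s ∈ Set.Icc a1 b1, ∃ u ∈ Set.Icc 0 L1, d (r (g1 s)) (β1 u) = 0)
    (p2 : ∀ u ∈ Set.Icc 0 L2, ∃ s ∈ Set.Icc a2 b2, β2 u = r (g2 s))
    (p3 : ∀ u ∈ Set.Icc 0 L3, ∃ s ∈ Set.Icc a3 b3, β3 u = r (g3 s)) {D : ℝ}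
    (H : ∀ s ∈ Set.Icc 0 L1,
      (∃ t ∈ Set.Icc 0 L2, d (β1 s) (β2 t) ≤ D) ∨
      (∃ t ∈ Set.Icc 0 L3, d (β1 s) (β3 t) ≤ D)) :
    ∀ s ∈ Set.Icc a1 b1,
      (∃ t ∈ Set.Icc a2 b2, d (r (g1 s)) (r (g2 t)) ≤ D) ∨
      (∃ t ∈ Set.Icc a3 b3, d (r (g1 s)) (r (g3 t)) ≤ D) := by
  intro s hs
  obtain ⟨u, hu, hz⟩ := p1 s hs
  rcases H u hu with ⟨t, ht, hd⟩ | ⟨t, ht, hd⟩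
  · obtain ⟨w, hw, hw'⟩ := p2 t ht
    refine Or.inl ⟨w, hw, ?_⟩
    rw [← hw']
    linarith [E.pm.tri (r (g1 s)) (β1 u) (β2 t)]
  · obtain ⟨w, hw, hw'⟩ := p3 t ht
    refine Or.inr ⟨w, hw, ?_⟩
    rw [← hw']
    linarith [E.pm.tri (r (g1 s)) (β1 u) (β3 t)]

lemma glue_transfer (E : Emb d e r h v) {p q : Y} {x y : X} (h0 : e p q = 0)
    (h1 : d (r p) x = 0) (h2 : d (r q) y = 0) : d x y = 0 := by
  have := (E.zero h0).1
  have n := E.pm.nonneg x y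
  have t1 := E.pm.tri x (r p) y
  have t2 := E.pm.tri (r p) (r q) y
  rw [E.pm.symm] at h1
  linarith

end AbstractPart

/-! ### Comparison of hyperbolicity constants -/

section Compare

variable {V W : Type} [Fintype V] [DecidableEq V] [Fintype W] [DecidableEq W]
  {G : SimpleGraph V} {G' : SimpleGraph W}

lemma triangleDelta_le_of_emb {r : MGPoint G' → MGPoint G} {h : MGPoint G' → ℝ} {v : MGPoint G}
    (E : Emb (mgDist G) (mgDist G') r h v) {K : ℝ} (hK0 : 0 ≤ K) (hK : ∀ p q, mgDist G p q ≤ K)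
    (T' : MGTriangle G') : ∃ T : MGTriangle G, triangleDelta T' ≤ triangleDelta T := by
  obtain ⟨a1, b1, a2, b2, a3, b3, g1, g2, g3, h1, h2, h3, k1, k2, k3⟩ := T'
  obtain ⟨L1, β1, G1, p1, q1, s1, f1⟩ := AGeo.proj E h1
  obtain ⟨L2, β2, G2, p2, q2, s2, f2⟩ := AGeo.proj E h2
  obtain ⟨L3, β3, G3, p3, q3, s3, f3⟩ := AGeo.proj E h3
  refine ⟨⟨0, L1, 0, L2, 0, L3, β1, β2, β3, G1, G2, G3, glue_transfer E k1 f1 s2,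
    glue_transfer E k2 f2 s3, glue_transfer E k3 f3 s1⟩, ?_⟩
  unfold triangleDelta
  apply csInf_le_csInf
  · exact ⟨0, fun x hx => hx.1⟩
  · exact ⟨K, hK0, fun s _ => Or.inl ⟨0, ⟨le_rfl, G2.1⟩, hK _ _⟩,
      fun s _ => Or.inl ⟨0, ⟨le_rfl, G1.1⟩, hK _ _⟩, fun s _ => Or.inl ⟨0, ⟨le_rfl, G1.1⟩, hK _ _⟩⟩
  · rintro D ⟨hD, H1, H2, H3⟩
    refine ⟨hD, ?_, ?_, ?_⟩
    · exact thin_side E h1 h2 h3 k1 k2 k3 hD (near_transfer E p1 q2 q3 H1)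
    · intro s hs
      exact (thin_side E h2 h3 h1 k2 k3 k1 hD
        (near_transfer E p2 q3 q1 (fun s hs => (H2 s hs).symm)) s hs).symm
    · exact thin_side E h3 h1 h2 k3 k1 k2 hD (near_transfer E p3 q1 q2 H3)

lemma triangleDelta_of_isom (i : MGPoint G → MGPoint G')
    (hi : ∀ p q, mgDist G' (i p) (i q) = mgDist G p q) (T : MGTriangle G) :
    ∃ T' : MGTriangle G', triangleDelta T = triangleDelta T' := by
  obtain ⟨a1, b1, a2, b2, a3, b3, g1, g2, g3, h1, h2, h3, k1, k2, k3⟩ := T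
  refine ⟨⟨a1, b1, a2, b2, a3, b3, fun s => i (g1 s), fun s => i (g2 s), fun s => i (g3 s),
    ⟨h1.1, ?_⟩, ⟨h2.1, ?_⟩, ⟨h3.1, ?_⟩, ?_, ?_, ?_⟩, ?_⟩
  · intro s hs t ht; rw [hi]; exact h1.2 s hs t ht
  · intro s hs t ht; rw [hi]; exact h2.2 s hs t ht
  · intro s hs t ht; rw [hi]; exact h3.2 s hs t ht
  · rw [hi]; exact k1
  · rw [hi]; exact k2
  · rw [hi]; exact k3
  · simp only [triangleDelta, hi]

lemma triangleDelta_le {K : ℝ} (hK0 : 0 ≤ K) (hK : ∀ p q, mgDist G p q ≤ K)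
    (T : MGTriangle G) : triangleDelta T ≤ K := by
  apply csInf_le ⟨0, fun x hx => hx.1⟩
  exact ⟨hK0, fun s _ => Or.inl ⟨_, ⟨le_rfl, T.h2.1⟩, hK _ _⟩,
      fun s _ => Or.inl ⟨_, ⟨le_rfl, T.h1.1⟩, hK _ _⟩, fun s _ => Or.inl ⟨_, ⟨le_rfl, T.h1.1⟩, hK _ _⟩⟩

lemma hypDelta_eq {r : MGPoint G' → MGPoint G} {h : MGPoint G' → ℝ} {v : MGPoint G}
    (E : Emb (mgDist G) (mgDist G') r h v) {K : ℝ} (hK0 : 0 ≤ K) (hK : ∀ p q, mgDist G p q ≤ K)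
    (i : MGPoint G → MGPoint G')
    (hi : ∀ p q, mgDist G' (i p) (i q) = mgDist G p q) : hypDelta G' = hypDelta G := by
  unfold hypDelta
  have T0 : MGTriangle G := ⟨0, 0, 0, 0, 0, 0, fun _ => v, fun _ => v, fun _ => v,
    ⟨le_rfl, by simp [E.pm.self]⟩, ⟨le_rfl, by simp [E.pm.self]⟩, ⟨le_rfl, by simp [E.pm.self]⟩,
    E.pm.self _, E.pm.self _, E.pm.self _⟩
  have up : ∀ x ∈ {d : ℝ | ∃ T : MGTriangle G', d = triangleDelta T},
      ∃ y ∈ {d : ℝ | ∃ T : MGTriangle G, d = triangleDelta T}, x ≤ y := by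
    rintro x ⟨T', rfl⟩
    obtain ⟨T, hT⟩ := triangleDelta_le_of_emb E hK0 hK T'
    exact ⟨_, ⟨T, rfl⟩, hT⟩
  have bd : BddAbove {d : ℝ | ∃ T : MGTriangle G, d = triangleDelta T} :=
    ⟨K, by rintro x ⟨T, rfl⟩; exact triangleDelta_le hK0 hK T⟩
  have bd' : BddAbove {d : ℝ | ∃ T : MGTriangle G', d = triangleDelta T} := by
    obtain ⟨M, hM⟩ := bd
    refine ⟨M, fun x hx => ?_⟩
    obtain ⟨y, hy, hxy⟩ := up x hx
    exact hxy.trans (hM hy)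
  have sub : {d : ℝ | ∃ T : MGTriangle G, d = triangleDelta T} ⊆
      {d : ℝ | ∃ T : MGTriangle G', d = triangleDelta T} := by
    rintro x ⟨T, rfl⟩
    exact triangleDelta_of_isom i hi T
  have ne : {d : ℝ | ∃ T : MGTriangle G, d = triangleDelta T}.Nonempty := ⟨_, T0, rfl⟩
  apply le_antisymm
  · apply csSup_le (ne.mono sub)
    intro x hx
    obtain ⟨y, hy, hxy⟩ := up x hx
    exact hxy.trans (le_csSup bd hy)
  · exact csSup_le_csSup bd' ne sub

end Compare


/-! ### The metric of a metric graph -/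

section Metric

variable {V : Type} [Fintype V] [DecidableEq V] {G : SimpleGraph V}

/-- `x` is the length of one of the candidate shortest paths from `p` to `q`. -/
def Cand (G : SimpleGraph V) (p q : MGPoint G) (x : ℝ) : Prop :=
  (p.1.1 = q.1.1 ∧ p.1.2.1 = q.1.2.1 ∧ x = |p.1.2.2 - q.1.2.2|) ∨
  (p.1.1 = q.1.2.1 ∧ p.1.2.1 = q.1.1 ∧ x = |p.1.2.2 - (1 - q.1.2.2)|) ∨
  x = p.1.2.2 + (G.dist p.1.1 q.1.1 : ℝ) + q.1.2.2 ∨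
  x = p.1.2.2 + (G.dist p.1.1 q.1.2.1 : ℝ) + (1 - q.1.2.2) ∨
  x = (1 - p.1.2.2) + (G.dist p.1.2.1 q.1.1 : ℝ) + q.1.2.2 ∨
  x = (1 - p.1.2.2) + (G.dist p.1.2.1 q.1.2.1 : ℝ) + (1 - q.1.2.2)

lemma dist_lt_card (hG : G.Connected) (a b : V) : (G.dist a b : ℝ) + 1 ≤ Fintype.card V := by
  obtain ⟨p, hp, hl⟩ := hG.exists_path_of_dist a b
  have := hp.length_lt
  rw [hl] at this
  exact_mod_cast this

lemma mgDist_le_cand (p q : MGPoint G) {x : ℝ} (h : Cand G p q x) : mgDist G p q ≤ x := by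
  unfold mgDist mgDistAux
  rcases h with ⟨h1, h2, rfl⟩ | ⟨h1, h2, rfl⟩ | rfl | rfl | rfl | rfl
  · rw [if_pos ⟨h1, h2⟩]; simp
  · rw [if_pos (c := p.1.1 = q.1.2.1 ∧ p.1.2.1 = q.1.1) ⟨h1, h2⟩]; simp
  all_goals simp

lemma mgDist_le_card (hG : G.Connected) (p q : MGPoint G) : mgDist G p q ≤ Fintype.card V := by
  have h1 := mgDist_le_cand p q (Or.inr (Or.inr (Or.inl rfl)))
  have h2 := mgDist_le_cand p q (Or.inr (Or.inr (Or.inr (Or.inl rfl))))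
  have h3 := mgDist_le_cand p q (Or.inr (Or.inr (Or.inr (Or.inr (Or.inl rfl)))))
  have h4 := mgDist_le_cand p q (Or.inr (Or.inr (Or.inr (Or.inr (Or.inr rfl)))))
  have d1 := dist_lt_card hG p.1.1 q.1.1
  have d2 := dist_lt_card hG p.1.1 q.1.2.1
  have d3 := dist_lt_card hG p.1.2.1 q.1.1
  have d4 := dist_lt_card hG p.1.2.1 q.1.2.1
  linarith

lemma cand_mgDist (hG : G.Connected) (p q : MGPoint G) : Cand G p q (mgDist G p q) := by
  have hc := mgDist_le_card hG p q
  revert hc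
  unfold Cand
  unfold mgDist mgDistAux
  generalize (p.1.2.2 + (G.dist p.1.1 q.1.1 : ℝ) + q.1.2.2) = m1
  generalize (p.1.2.2 + (G.dist p.1.1 q.1.2.1 : ℝ) + (1 - q.1.2.2)) = m2
  generalize ((1 - p.1.2.2) + (G.dist p.1.2.1 q.1.1 : ℝ) + q.1.2.2) = m3
  generalize ((1 - p.1.2.2) + (G.dist p.1.2.1 q.1.2.1 : ℝ) + (1 - q.1.2.2)) = m4
  generalize |p.1.2.2 - q.1.2.2| = m5
  generalize |p.1.2.2 - (1 - q.1.2.2)| = m6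
  intro hc
  generalize hA : (if p.1.1 = q.1.1 ∧ p.1.2.1 = q.1.2.1 then m5 else (Fintype.card V : ℝ) + 1) = A
    at hc ⊢
  generalize hB : (if p.1.1 = q.1.2.1 ∧ p.1.2.1 = q.1.1 then m6 else (Fintype.card V : ℝ) + 1) = B
    at hc ⊢
  rcases min_choice (min A B) (min (min m1 m2) (min m3 m4)) with h | h <;> rw [h] at hc ⊢
  · rcases min_choice A B with h | h <;> rw [h] at hc ⊢
    · split_ifs at hA with hh
      · exact Or.inl ⟨hh.1, hh.2, hA.symm⟩
      · linarith
    · split_ifs at hB with hh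
      · exact Or.inr (Or.inl ⟨hh.1, hh.2, hB.symm⟩)
      · linarith
  · rcases min_choice (min m1 m2) (min m3 m4) with h | h <;> rw [h]
    · rcases min_choice m1 m2 with h | h <;> rw [h] <;> simp
    · rcases min_choice m3 m4 with h | h <;> rw [h] <;> simp

lemma mgDist_unique (hG : G.Connected) {p q : MGPoint G} {m : ℝ} (h1 : Cand G p q m)
    (h2 : ∀ x, Cand G p q x → m ≤ x) : mgDist G p q = m :=
  le_antisymm (mgDist_le_cand p q h1) (h2 _ (cand_mgDist hG p q))

lemma cand_symm {p q : MGPoint G} {x : ℝ} (h : Cand G p q x) : Cand G q p x := by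
  unfold Cand at *
  rw [G.dist_comm (u := q.1.1), G.dist_comm (u := q.1.1), G.dist_comm (u := q.1.2.1),
    G.dist_comm (u := q.1.2.1)]
  rcases h with ⟨h1, h2, rfl⟩ | ⟨h1, h2, rfl⟩ | rfl | rfl | rfl | rfl
  · exact Or.inl ⟨h1.symm, h2.symm, abs_sub_comm _ _⟩
  · refine Or.inr (Or.inl ⟨h2.symm, h1.symm, ?_⟩)
    congr 1; ring
  · refine Or.inr (Or.inr (Or.inl ?_)); ring
  · refine Or.inr (Or.inr (Or.inr (Or.inr (Or.inl ?_)))); ring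
  · refine Or.inr (Or.inr (Or.inr (Or.inl ?_))); ring
  · refine Or.inr (Or.inr (Or.inr (Or.inr (Or.inr ?_)))); ring

lemma mgDist_comm (hG : G.Connected) (p q : MGPoint G) : mgDist G p q = mgDist G q p :=
  le_antisymm (mgDist_le_cand _ _ (cand_symm (cand_mgDist hG q p)))
    (mgDist_le_cand _ _ (cand_symm (cand_mgDist hG p q)))

/-- The same point with the edge traversed in the other direction. -/
def mgFlip (p : MGPoint G) : MGPoint G :=
  ⟨(p.1.2.1, p.1.1, 1 - p.1.2.2), p.2.1.symm, by linarith [p.2.2.2], by linarith [p.2.2.1]⟩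

lemma cand_flip {p q : MGPoint G} {x : ℝ} (h : Cand G p q x) : Cand G p (mgFlip q) x := by
  unfold Cand mgFlip at *
  simp only [sub_sub_cancel]
  tauto

lemma mgFlip_flip (p : MGPoint G) : mgFlip (mgFlip p) = p := by
  apply Subtype.ext
  simp [mgFlip]

lemma mgDist_flip (hG : G.Connected) (p q : MGPoint G) : mgDist G p (mgFlip q) = mgDist G p q := by
  apply le_antisymm (mgDist_le_cand _ _ (cand_flip (cand_mgDist hG p q)))
  have := mgDist_le_cand _ _ (cand_flip (cand_mgDist hG p (mgFlip q)))
  rwa [mgFlip_flip] at this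

lemma mgDist_nonneg (hG : G.Connected) (p q : MGPoint G) : 0 ≤ mgDist G p q := by
  have h := cand_mgDist hG p q
  have p1 := p.2.2.1
  have p2 := p.2.2.2
  have q1 := q.2.2.1
  have q2 := q.2.2.2
  have d1 : (0:ℝ) ≤ G.dist p.1.1 q.1.1 := Nat.cast_nonneg _
  have d2 : (0:ℝ) ≤ G.dist p.1.1 q.1.2.1 := Nat.cast_nonneg _
  have d3 : (0:ℝ) ≤ G.dist p.1.2.1 q.1.1 := Nat.cast_nonneg _
  have d4 : (0:ℝ) ≤ G.dist p.1.2.1 q.1.2.1 := Nat.cast_nonneg _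
  rcases h with ⟨-, -, h⟩ | ⟨-, -, h⟩ | h | h | h | h <;> rw [h]
  · exact abs_nonneg _
  · exact abs_nonneg _
  all_goals linarith

lemma mgDist_self (hG : G.Connected) (p : MGPoint G) : mgDist G p p = 0 := by
  apply le_antisymm _ (mgDist_nonneg hG p p)
  exact mgDist_le_cand p p (Or.inl ⟨rfl, rfl, by simp⟩)

lemma mgDist_tri (hG : G.Connected) (p q o : MGPoint G) :
    mgDist G p o ≤ mgDist G p q + mgDist G q o := by
  have c1 := cand_mgDist hG p q
  have c2 := cand_mgDist hG q o
  have key : ∀ x, Cand G p o x → mgDist G p o ≤ x := fun x hx => mgDist_le_cand p o hx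
  generalize mgDist G p q = X at *
  generalize mgDist G q o = Y at *
  generalize mgDist G p o = Z at *
  obtain ⟨⟨a, b, t⟩, hab, ht0, ht1⟩ := p
  obtain ⟨⟨a', b', t'⟩, hab', ht0', ht1'⟩ := q
  obtain ⟨⟨a'', b'', t''⟩, hab'', ht0'', ht1''⟩ := o
  simp only [Cand] at *
  have k1 := key _ (Or.inr (Or.inr (Or.inl rfl)))
  have k2 := key _ (Or.inr (Or.inr (Or.inr (Or.inl rfl))))
  have k3 := key _ (Or.inr (Or.inr (Or.inr (Or.inr (Or.inl rfl)))))
  have k4 := key _ (Or.inr (Or.inr (Or.inr (Or.inr (Or.inr rfl)))))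
  have tr : ∀ x y z, (G.dist x z : ℝ) ≤ G.dist x y + G.dist y z := by
    intro x y z
    exact_mod_cast hG.dist_triangle
  have e1 : (G.dist a' b' : ℝ) = 1 := by exact_mod_cast dist_eq_one_iff_adj.2 hab'
  have e2 : (G.dist b' a' : ℝ) = 1 := by exact_mod_cast dist_eq_one_iff_adj.2 hab'.symm
  have cross : ∀ x z, (G.dist x z : ℝ) ≤ G.dist x a' + 1 + G.dist b' z := by
    intro x z
    linarith [tr x a' z, tr a' b' z]
  have cross' : ∀ x z, (G.dist x z : ℝ) ≤ G.dist x b' + 1 + G.dist a' z := by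
    intro x z
    linarith [tr x b' z, tr b' a' z]
  rcases c1 with ⟨h1, h2, h⟩ | ⟨h1, h2, h⟩ | h | h | h | h
  · subst h1 h2
    have x1 := le_abs_self (t - t')
    have x2 := neg_abs_le (t - t')
    rcases c2 with ⟨h1, h2, h'⟩ | ⟨h1, h2, h'⟩ | h' | h' | h' | h'
    · have := key _ (Or.inl ⟨h1, h2, rfl⟩)
      linarith [abs_sub_le t t' t'']
    · have := key _ (Or.inr (Or.inl ⟨h1, h2, rfl⟩))
      linarith [abs_sub_le t t' (1 - t'')]
    all_goals linarith
  · subst h1 h2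
    have x1 := le_abs_self (t - (1 - t'))
    have x2 := neg_abs_le (t - (1 - t'))
    rcases c2 with ⟨h1, h2, h'⟩ | ⟨h1, h2, h'⟩ | h' | h' | h' | h'
    · have := key _ (Or.inr (Or.inl ⟨h2, h1, rfl⟩))
      have h5 : |t' - t''| = |(1 - t') - (1 - t'')| := by rw [abs_sub_comm]; congr 1; ring
      linarith [abs_sub_le t (1 - t') (1 - t'')]
    · have := key _ (Or.inl ⟨h2, h1, rfl⟩)
      have h5 : |t' - (1 - t'')| = |(1 - t') - t''| := by rw [abs_sub_comm]; congr 1; ring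
      linarith [abs_sub_le t (1 - t') t'']
    all_goals linarith
  all_goals
    rcases c2 with ⟨h1, h2, h'⟩ | ⟨h1, h2, h'⟩ | h' | h' | h' | h'
    · subst h1 h2
      have x1 := le_abs_self (t' - t'')
      have x2 := neg_abs_le (t' - t'')
      linarith
    · subst h1 h2
      have x1 := le_abs_self (t' - (1 - t''))
      have x2 := neg_abs_le (t' - (1 - t''))
      linarith
    all_goals
      linarith [tr a a' a'', tr a a' b'', tr b a' a'', tr b a' b'', tr a b' a'', tr a b' b'',
        tr b b' a'', tr b b' b'', cross a a'', cross a b'', cross b a'', cross b b'',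
        cross' a a'', cross' a b'', cross' b a'', cross' b b'']

lemma mgDist_pm (hG : G.Connected) : PM (mgDist G) :=
  ⟨mgDist_self hG, mgDist_nonneg hG, mgDist_comm hG, mgDist_tri hG⟩

end Metric

/-! ### Adding a pendant vertex -/

section Pendant

/-- `G'` is `G` (embedded through `f`) with a pendant vertex `w` attached to `v`. -/
structure Pend {V W : Type} (G : SimpleGraph V) (G' : SimpleGraph W) (f : V → W) (w : W) (v : V) :
    Prop where
  inj : Function.Injective f
  adj : ∀ a b, G'.Adj (f a) (f b) ↔ G.Adj a b
  adjw : ∀ b, G'.Adj w b ↔ b = f v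
  cover : ∀ a, a = w ∨ ∃ x, a = f x
  ne : ∀ x, w ≠ f x

variable {V W : Type} {G : SimpleGraph V} {G' : SimpleGraph W} {f : V → W} {w : W} {v : V}

/-- The embedding as a graph homomorphism. -/
def Pend.hom (P : Pend G G' f w v) : G →g G' := ⟨f, fun {a b} h => (P.adj a b).2 h⟩

lemma Pend.connected (P : Pend G G' f w v) (hG : G.Connected) : G'.Connected := by
  have key : ∀ a, G'.Reachable (f v) a := by
    intro a
    rcases P.cover a with rfl | ⟨x, rfl⟩
    · exact ((P.adjw _).2 rfl).symm.reachable
    · exact (hG.preconnected v x).map P.hom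
  have : Nonempty W := ⟨w⟩
  exact ⟨fun a b => (key a).symm.trans (key b)⟩

lemma Pend.dist_lower (P : Pend G G' f w v) (hG : G.Connected) {a b : W} (p : G'.Walk a b) (y : V)
    (hb : b = f y) : (∀ x, a = f x → G.dist x y ≤ p.length) ∧
      (a = w → G.dist v y + 1 ≤ p.length) := by
  induction p with
  | nil =>
    refine ⟨fun x hx => ?_, fun h => ?_⟩
    · have : x = y := P.inj (hx.symm.trans hb)
      simp [this]
    · exact absurd (h.symm.trans hb) (P.ne y)
  | @cons a c b hac p ih =>
    obtain ⟨i1, i2⟩ := ih hb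
    rw [Walk.length_cons]
    refine ⟨fun x hx => ?_, fun h => ?_⟩
    · rcases P.cover c with h | ⟨z, h⟩
      · subst h
        have := (P.adjw _).1 hac.symm
        have hxv : x = v := P.inj (hx.symm.trans this)
        have := i2 rfl
        rw [hxv]
        omega
      · subst h hx
        have h1 := dist_eq_one_iff_adj.2 ((P.adj _ _).1 hac)
        have h2 := i1 z rfl
        have h3 := hG.dist_triangle (u := x) (v := z) (w := y)
        omega
    · subst h
      have := i1 v ((P.adjw _).1 hac)
      omega

lemma Pend.dist_ff (P : Pend G G' f w v) (hG : G.Connected) (x y : V) :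
    G'.dist (f x) (f y) = G.dist x y := by
  apply le_antisymm
  · obtain ⟨p, hp⟩ := hG.exists_walk_length_eq_dist x y
    have := dist_le (p.map P.hom)
    rw [Walk.length_map, hp] at this
    exact this
  · obtain ⟨p, hp⟩ := (P.connected hG).exists_walk_length_eq_dist (f x) (f y)
    rw [← hp]
    exact (P.dist_lower hG p y rfl).1 x rfl

lemma Pend.dist_wf (P : Pend G G' f w v) (hG : G.Connected) (y : V) :
    G'.dist w (f y) = G.dist v y + 1 := by
  apply le_antisymm
  · have h1 := (P.connected hG).dist_triangle (u := w) (v := f v) (w := f y)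
    have h2 := dist_eq_one_iff_adj.2 ((P.adjw _).2 rfl)
    rw [P.dist_ff hG, h2] at h1
    omega
  · obtain ⟨p, hp⟩ := (P.connected hG).exists_walk_length_eq_dist w (f y)
    rw [← hp]
    exact (P.dist_lower hG p y rfl).2 rfl

lemma Pend.lift (P : Pend G G' f w v) {a b : W} (p : G'.Walk a b) (hp : w ∉ p.support) :
    ∀ x y (hx : f x = a) (hy : f y = b), ∃ q : G.Walk x y,
      q.map P.hom = p.copy hx.symm hy.symm := by
  induction p with
  | nil =>
    intro x y hx hy
    have : x = y := P.inj (hx.trans hy.symm)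
    subst this
    subst hx
    exact ⟨Walk.nil, rfl⟩
  | @cons a c b hac p ih =>
    intro x y hx hy
    rw [Walk.support_cons, List.mem_cons, not_or] at hp
    have hc : c ≠ w := by
      rintro rfl
      exact hp.2 p.start_mem_support
    obtain ⟨z, rfl⟩ := (P.cover c).resolve_left hc
    subst hx hy
    obtain ⟨q, hq⟩ := ih hp.2 z y rfl rfl
    refine ⟨Walk.cons ((P.adj _ _).1 hac) q, ?_⟩
    rw [Walk.map_cons, hq]
    rfl

lemma Pend.notin (P : Pend G G' f w v) {a : W} {p : G'.Walk a a} (hp : p.IsCycle) :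
    w ∉ p.support := by
  intro hw
  have h2 := hp.ncard_neighborSet_toSubgraph_eq_two hw
  have hs : p.toSubgraph.neighborSet w ⊆ {f v} := by
    intro b hb
    exact (P.adjw b).1 (p.toSubgraph.adj_sub hb)
  have := Set.ncard_le_ncard hs (Set.finite_singleton _)
  rw [h2, Set.ncard_singleton] at this
  omega

lemma Pend.cycles (P : Pend G G' f w v) (k : ℕ) :
    (∃ (a : W) (p : G'.Walk a a), p.IsCycle ∧ p.length = k) ↔
    (∃ (a : V) (p : G.Walk a a), p.IsCycle ∧ p.length = k) := by
  constructor
  · rintro ⟨a, p, hp, hk⟩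
    have hw := P.notin hp
    have ha : a ≠ w := by
      rintro rfl
      exact hw p.start_mem_support
    obtain ⟨x, rfl⟩ := (P.cover a).resolve_left ha
    obtain ⟨q, hq⟩ := P.lift p hw x x rfl rfl
    rw [Walk.copy_rfl_rfl] at hq
    refine ⟨x, q, ?_, ?_⟩
    · rw [← hq] at hp
      exact (Walk.isCycle_map_iff_of_injective P.inj).1 hp
    · rw [← hk, ← hq]
      exact (Walk.length_map _ _).symm
  · rintro ⟨a, p, hp, hk⟩
    refine ⟨f a, p.map P.hom, hp.map P.inj, ?_⟩
    exact (Walk.length_map _ _).trans hk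

lemma Pend.circ (P : Pend G G' f w v) : circumference G' = circumference G := by
  unfold circumference
  congr 1
  ext k
  exact P.cycles k

lemma Pend.girth (P : Pend G G' f w v) : G'.girth = G.girth := by
  have : G'.egirth = G.egirth := by
    apply le_antisymm
    · rw [le_egirth]
      intro a p hp
      obtain ⟨b, q, hq, hl⟩ := (P.cycles _).2 ⟨a, p, hp, rfl⟩
      rw [← hl]
      exact egirth_le_length hq
    · rw [le_egirth]
      intro a p hp
      obtain ⟨b, q, hq, hl⟩ := (P.cycles _).1 ⟨a, p, hp, rfl⟩
      rw [← hl]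
      exact egirth_le_length hq
  unfold SimpleGraph.girth
  rw [this]

variable [Fintype V] [DecidableEq V] [Fintype W] [DecidableEq W]

/-- Inclusion of metric graphs. -/
def Pend.incl (P : Pend G G' f w v) (p : MGPoint G) : MGPoint G' :=
  ⟨(f p.1.1, f p.1.2.1, p.1.2.2), (P.adj _ _).2 p.2.1, p.2.2⟩

/-- Point of the pendant edge at distance `s` from `v`. -/
def Pend.pt (P : Pend G G' f w v) (s : ℝ) (hs : s ∈ Set.Icc (0 : ℝ) 1) : MGPoint G' :=
  ⟨(f v, w, s), ((P.adjw _).2 rfl).symm, hs⟩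

lemma Pend.form_ii (P : Pend G G' f w v) (hG : G.Connected) (p q : MGPoint G) :
    mgDist G' (P.incl p) (P.incl q) = mgDist G p q := by
  have key : ∀ x, Cand G' (P.incl p) (P.incl q) x ↔ Cand G p q x := by
    intro x
    simp only [Cand, Pend.incl, P.dist_ff hG, P.inj.eq_iff]
  apply mgDist_unique (P.connected hG) ((key _).2 (cand_mgDist hG p q))
  intro x hx
  exact mgDist_le_cand _ _ ((key x).1 hx)

lemma Pend.form_ip (P : Pend G G' f w v) (hG : G.Connected) {v0 : V} (hv : G.Adj v v0)
    (p : MGPoint G) (s : ℝ) (hs : s ∈ Set.Icc (0 : ℝ) 1) :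
    mgDist G' (P.incl p) (P.pt s hs) =
      mgDist G p ⟨(v, v0, 0), hv, le_rfl, zero_le_one⟩ + s := by
  have hG' := P.connected hG
  have e0 : ∀ x, G'.dist (f x) w = G.dist x v + 1 := by
    intro x
    rw [dist_comm, P.dist_wf hG, dist_comm]
  have c1 := cand_mgDist hG p ⟨(v, v0, 0), hv, le_rfl, zero_le_one⟩
  have c2 := cand_mgDist hG' (P.incl p) (P.pt s hs)
  have l1 := fun x => mgDist_le_cand (x := x) p ⟨(v, v0, 0), hv, le_rfl, zero_le_one⟩
  have l2 := fun x => mgDist_le_cand (x := x) (P.incl p) (P.pt s hs)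
  generalize mgDist G p ⟨(v, v0, 0), hv, le_rfl, zero_le_one⟩ = X at *
  generalize mgDist G' (P.incl p) (P.pt s hs) = Y at *
  obtain ⟨⟨a, b, t⟩, hab, ht0, ht1⟩ := p
  obtain ⟨hs0, hs1⟩ := hs
  simp only [Cand, Pend.incl, Pend.pt, P.dist_ff hG, e0, P.inj.eq_iff] at *
  have k1 := l1 _ (Or.inr (Or.inr (Or.inl rfl)))
  have k3 := l1 _ (Or.inr (Or.inr (Or.inr (Or.inr (Or.inl rfl)))))
  have m1 := l2 _ (Or.inr (Or.inr (Or.inl rfl)))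
  have m3 := l2 _ (Or.inr (Or.inr (Or.inr (Or.inr (Or.inl rfl)))))
  have hn : ∀ x, (f x = w) = False := fun x => by
    simp only [eq_iff_iff, iff_false]
    exact fun h => P.ne x h.symm
  simp only [hn, false_and, and_false, false_or] at c2
  have tr : ∀ x, (G.dist x v : ℝ) ≤ G.dist x v0 + 1 := by
    intro x
    have h1 := hG.dist_triangle (u := x) (v := v0) (w := v)
    rw [dist_eq_one_iff_adj.2 hv.symm] at h1
    exact_mod_cast h1
  have ta := tr a
  have tb := tr b
  push_cast at *
  apply le_antisymm
  · rcases c1 with ⟨h1, h2, h⟩ | ⟨h1, h2, h⟩ | h | h | h | h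
    · subst h1
      rw [sub_zero, abs_of_nonneg ht0] at h
      simp only [dist_self, Nat.cast_zero] at *
      linarith
    · subst h2
      rw [sub_zero, abs_of_nonpos (by linarith)] at h
      simp only [dist_self, Nat.cast_zero] at *
      linarith
    all_goals linarith
  · rcases c2 with h | h | h | h <;> linarith

lemma Pend.form_pp (P : Pend G G' f w v) (hG : G.Connected)
    (s : ℝ) (hs : s ∈ Set.Icc (0 : ℝ) 1) (t : ℝ) (ht : t ∈ Set.Icc (0 : ℝ) 1) :
    mgDist G' (P.pt s hs) (P.pt t ht) = |s - t| := by
  have hG' := P.connected hG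
  apply mgDist_unique hG'
  · exact Or.inl ⟨rfl, rfl, rfl⟩
  · intro x hx
    have e0 : G'.dist (f v) w = 1 := by
      rw [dist_comm, P.dist_wf hG, SimpleGraph.dist_self]
    have e1 : G'.dist w (f v) = 1 := by
      rw [P.dist_wf hG, SimpleGraph.dist_self]
    obtain ⟨hs0, hs1⟩ := hs
    obtain ⟨ht0, ht1⟩ := ht
    simp only [Cand, Pend.pt, e0, e1, SimpleGraph.dist_self] at hx
    push_cast at hx
    rw [abs_le]
    rcases hx with ⟨h1, h2, h⟩ | ⟨h1, h2, h⟩ | h | h | h | h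
    · rw [h]
      exact abs_le.1 le_rfl
    · exact absurd h2 (P.ne v)
    all_goals constructor <;> linarith

/-- `x` is the projection and `η` the height of the point `p`. -/
def Pend.Rel (P : Pend G G' f w v) (vX : MGPoint G) (p : MGPoint G') (x : MGPoint G) (η : ℝ) :
    Prop :=
  (p = P.incl x ∧ η = 0) ∨
  (x = vX ∧ ∃ hs : η ∈ Set.Icc (0 : ℝ) 1, p = P.pt η hs ∨ p = mgFlip (P.pt η hs))

lemma Pend.exists_rel (P : Pend G G' f w v) (vX : MGPoint G) (p : MGPoint G') :
    ∃ x η, P.Rel vX p x η := by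
  obtain ⟨⟨a, b, t⟩, hab, ht⟩ := p
  rcases P.cover a with rfl | ⟨x, rfl⟩
  · have := (P.adjw _).1 hab
    simp only at this
    subst this
    refine ⟨vX, 1 - t, Or.inr ⟨rfl, ⟨by linarith [ht.2], by linarith [ht.1]⟩, Or.inr ?_⟩⟩
    apply Subtype.ext
    simp [mgFlip, Pend.pt]
  · rcases P.cover b with rfl | ⟨y, rfl⟩
    · have := P.inj ((P.adjw _).1 hab.symm)
      subst this
      exact ⟨vX, t, Or.inr ⟨rfl, ht, Or.inl rfl⟩⟩
    · exact ⟨⟨(x, y, t), (P.adj _ _).1 hab, ht⟩, 0, Or.inl ⟨rfl, rfl⟩⟩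

lemma Pend.rel_form (P : Pend G G' f w v) (hG : G.Connected) {v0 : V} (hv : G.Adj v v0)
    {vX : MGPoint G} (hX : vX = ⟨(v, v0, 0), hv, le_rfl, zero_le_one⟩) {p q : MGPoint G'}
    {x y : MGPoint G} {η θ : ℝ} (h1 : P.Rel vX p x η) (h2 : P.Rel vX q y θ) :
    mgDist G' p q = mgDist G x y + |η - θ| := by
  have hG' := P.connected hG
  have fl : ∀ a b : MGPoint G', mgDist G' (mgFlip a) b = mgDist G' a b := by
    intro a b
    rw [mgDist_comm hG', mgDist_flip hG', mgDist_comm hG']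
  rcases h1 with ⟨rfl, rfl⟩ | ⟨rfl, hs, h1⟩ <;> rcases h2 with ⟨rfl, rfl⟩ | ⟨rfl, ht, h2⟩
  · rw [P.form_ii hG]; simp
  · have : mgDist G' (P.incl x) q = mgDist G' (P.incl x) (P.pt θ ht) := by
      rcases h2 with rfl | rfl
      · rfl
      · rw [mgDist_flip hG']
    rw [this, P.form_ip hG hv, hX, zero_sub, abs_neg, abs_of_nonneg ht.1]
  · have : mgDist G' p (P.incl y) = mgDist G' (P.incl y) (P.pt η hs) := by
      rw [mgDist_comm hG']
      rcases h1 with rfl | rfl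
      · rfl
      · rw [mgDist_flip hG']
    rw [this, P.form_ip hG hv, mgDist_comm hG, hX, sub_zero, abs_of_nonneg hs.1]
  · have : mgDist G' p q = mgDist G' (P.pt η hs) (P.pt θ ht) := by
      rcases h1 with rfl | rfl <;> rcases h2 with rfl | rfl <;>
        simp only [fl, mgDist_flip hG']
    rw [this, P.form_pp hG, mgDist_self hG, zero_add]

lemma Pend.hypDelta (P : Pend G G' f w v) (hG : G.Connected) {v0 : V} (hv : G.Adj v v0) :
    hypDelta G' = hypDelta G := by
  choose r h hr using P.exists_rel ⟨(v, v0, 0), hv, le_rfl, zero_le_one⟩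
  have E : Emb (mgDist G) (mgDist G') r h ⟨(v, v0, 0), hv, le_rfl, zero_le_one⟩ := by
    refine ⟨mgDist_pm hG, fun p q => P.rel_form hG hv rfl (hr p) (hr q), fun p => ?_, fun p hp => ?_⟩
    · rcases hr p with ⟨-, h⟩ | ⟨-, h, -⟩
      · exact h.ge
      · exact h.1
    · rcases hr p with ⟨-, h⟩ | ⟨h, -⟩
      · exact absurd h hp.ne'
      · exact h
  exact hypDelta_eq E (Nat.cast_nonneg _) (mgDist_le_card hG) P.incl (P.form_ii hG)

end Pendant

/-- `G` with a pendant vertex attached at `v`. -/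
def addPendant {n : ℕ} (G : SimpleGraph (Fin n)) (v : Fin n) : SimpleGraph (Fin (n + 1)) where
  Adj a b := (∃ x y, a = Fin.castSucc x ∧ b = Fin.castSucc y ∧ G.Adj x y) ∨
    (a = Fin.last n ∧ b = Fin.castSucc v) ∨ (b = Fin.last n ∧ a = Fin.castSucc v)
  symm := ⟨by
    rintro a b (⟨x, y, h1, h2, h3⟩ | h | h)
    · exact Or.inl ⟨y, x, h2, h1, h3.symm⟩
    · exact Or.inr (Or.inr h)
    · exact Or.inr (Or.inl h)⟩
  loopless := ⟨by
    rintro a (⟨x, y, h1, h2, h3⟩ | ⟨h1, h2⟩ | ⟨h1, h2⟩)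
    · exact h3.ne (Fin.castSucc_injective n (h1.symm.trans h2))
    · exact (Fin.castSucc_lt_last v).ne (h2.symm.trans h1)
    · exact (Fin.castSucc_lt_last v).ne (h2.symm.trans h1)⟩

lemma addPendant_pend {n : ℕ} (G : SimpleGraph (Fin n)) (v : Fin n) :
    Pend G (addPendant G v) Fin.castSucc (Fin.last n) v := by
  have hne : ∀ x : Fin n, Fin.last n ≠ Fin.castSucc x := fun x => (Fin.castSucc_lt_last x).ne'
  refine ⟨Fin.castSucc_injective n, ?_, ?_, ?_, hne⟩
  · intro a b
    constructor
    · rintro (⟨x, y, h1, h2, h3⟩ | ⟨h1, h2⟩ | ⟨h1, h2⟩)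
      · rw [Fin.castSucc_injective n h1, Fin.castSucc_injective n h2]
        exact h3
      · exact absurd h1.symm (hne _)
      · exact absurd h1.symm (hne _)
    · intro h
      exact Or.inl ⟨a, b, rfl, rfl, h⟩
  · intro b
    constructor
    · rintro (⟨x, y, h1, h2, h3⟩ | ⟨h1, h2⟩ | ⟨h1, h2⟩)
      · exact absurd h1 (hne _)
      · exact h2
      · exact absurd h2 (hne _)
    · intro h
      exact Or.inr (Or.inl ⟨rfl, h⟩)
  · intro a
    rcases Fin.eq_castSucc_or_eq_last a with ⟨x, h⟩ | h
    · exact Or.inr ⟨x, h⟩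
    · exact Or.inl h

lemma step (g c n : ℕ) (hn : 2 ≤ n) (G : SimpleGraph (Fin n)) (hG : memGclass g c G) :
    ∃ G' : SimpleGraph (Fin (n + 1)), memGclass g c G' ∧ hypDelta G' = hypDelta G := by
  obtain ⟨hc, hg, hcirc⟩ := hG
  let v : Fin n := ⟨0, by omega⟩
  have : Nontrivial (Fin n) := Fin.nontrivial_iff_two_le.2 hn
  obtain ⟨v0, hv⟩ := hc.preconnected.exists_adj_of_nontrivial v
  have P := addPendant_pend G v
  exact ⟨addPendant G v, ⟨P.connected hc, P.girth.trans hg, P.circ.trans hcirc⟩, P.hypDelta hc hv⟩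

lemma steps (g c n n' : ℕ) (hn : 2 ≤ n) (hnn : n ≤ n') (G : SimpleGraph (Fin n))
    (hG : memGclass g c G) :
    ∃ G' : SimpleGraph (Fin n'), memGclass g c G' ∧ hypDelta G' = hypDelta G := by
  induction n', hnn using Nat.le_induction with
  | base => exact ⟨G, hG, rfl⟩
  | succ m hm ih =>
    obtain ⟨H, hH, hd⟩ := ih
    obtain ⟨K, hK, hd'⟩ := step g c m (hn.trans hm) H hH
    exact ⟨K, hK, hd'.trans hd⟩

/-- Lemma (Y): If `(g,c,n)` is v-admissible and `n' ≥ n`, then `(g,c,n')` is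
v-admissible and `A(g,c,n') ≤ A(g,c,n) ≤ B(g,c,n) ≤ B(g,c,n')`. -/
theorem Agcn_Bgcn_monotone (g c n n' : ℕ) (h3 : 3 ≤ g) (hgc : g ≤ c) (hcn : c ≤ n)
    (hadm : ∃ G : SimpleGraph (Fin n), memGclass g c G) (hn : n ≤ n') :
    (∃ G : SimpleGraph (Fin n'), memGclass g c G) ∧
    Agcn g c n' ≤ Agcn g c n ∧ Agcn g c n ≤ Bgcn g c n ∧ Bgcn g c n ≤ Bgcn g c n' := by
  have sub : {d : ℝ | ∃ G : SimpleGraph (Fin n), memGclass g c G ∧ d = hypDelta G} ⊆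
      {d : ℝ | ∃ G : SimpleGraph (Fin n'), memGclass g c G ∧ d = hypDelta G} := by
    rintro d ⟨G, hG, rfl⟩
    obtain ⟨G', hG', hd⟩ := steps g c n n' (by omega) hn G hG
    exact ⟨G', hG', hd.symm⟩
  have fin : ∀ m, {d : ℝ | ∃ G : SimpleGraph (Fin m), memGclass g c G ∧ d = hypDelta G}.Finite := by
    intro m
    apply (Set.finite_range (fun G : SimpleGraph (Fin m) => hypDelta G)).subset
    rintro d ⟨G, -, rfl⟩
    exact ⟨G, rfl⟩
  obtain ⟨G, hG⟩ := hadm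
  have ne : {d : ℝ | ∃ G : SimpleGraph (Fin n), memGclass g c G ∧ d = hypDelta G}.Nonempty :=
    ⟨_, G, hG, rfl⟩
  refine ⟨?_, ?_, ?_, ?_⟩
  · obtain ⟨G', hG', -⟩ := steps g c n n' (by omega) hn G hG
    exact ⟨G', hG'⟩
  · exact csInf_le_csInf (fin n').bddBelow ne sub
  · exact csInf_le_csSup ne (fin n).bddBelow (fin n).bddAbove
  · exact csSup_le_csSup (fin n').bddAbove ne sub
end
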